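/- arXiv:2205.14043 — 2 statements merged into one kernel-verified Lean document; each statement's English description precedes it below -/
import Mathlib

section
/- The number of Gaussian integers a + bi with minimal Euclidean function value φ_{ℤ[i]}(a+bi) = 2k equals 14·4^k − 14·2^k + 4, and the number with value 2k+1 equals 28·4^k − 20·2^k + 4, for k ≥ 1. -/
def MotzkinSet : ℕ → Set GaussianInt
  | 0 => {z | z = 0 ∨ IsUnit z}
  | n + 1 => MotzkinSet n ∪ {β | ∀ x : GaussianInt, ∃ r ∈ MotzkinSet n, β ∣ (x - r)}

noncomputable def phi (z : GaussianInt) : ℕ := sInf {n | z ∈ MotzkinSet n}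

/-- The octagon widths. -/
def ww : ℕ → ℤ
  | 0 => 3
  | 1 => 4
  | n + 2 => 2 * ww n

def Oct (n : ℕ) (x y : ℤ) : Prop :=
  x ≤ ww n - 2 ∧ -x ≤ ww n - 2 ∧ y ≤ ww n - 2 ∧ -y ≤ ww n - 2 ∧
  x + y ≤ ww (n+1) - 3 ∧ x - y ≤ ww (n+1) - 3 ∧ -x + y ≤ ww (n+1) - 3 ∧ -x - y ≤ ww (n+1) - 3

def BB : ℕ → ℤ → ℤ → Prop
  | 0, x, y => x + y ≤ 1 ∧ x - y ≤ 1 ∧ -x + y ≤ 1 ∧ -x - y ≤ 1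
  | n + 1, x, y => ((x + y) % 2 = 1 ∧ Oct (n+1) x y) ∨ ∃ u v, x = u - v ∧ y = u + v ∧ BB n u v

theorem ww_two (n : ℕ) : ww (n+2) = 2 * ww n := rfl

theorem ww_form (k : ℕ) : ww (2*k) = 3 * 2^k ∧ ww (2*k+1) = 4 * 2^k := by
  induction k with
  | zero => simp [ww]
  | succ k ih =>
    have h1 : ww (2*(k+1)) = 2 * ww (2*k) := rfl
    have h2 : ww (2*(k+1)+1) = 2 * ww (2*k+1) := rfl
    rw [h1, h2, ih.1, ih.2, pow_succ]
    constructor <;> ring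

theorem ww_cases (n : ℕ) : ∃ k : ℕ, ∃ K : ℤ, K = 2^k ∧ 1 ≤ K ∧
    ((ww n = 3 * K ∧ ww (n+1) = 4 * K ∧ ww (n+2) = 6 * K ∧ ww (n+3) = 8 * K) ∨
     (ww n = 4 * K ∧ ww (n+1) = 6 * K ∧ ww (n+2) = 8 * K ∧ ww (n+3) = 12 * K)) := by
  rcases Nat.even_or_odd' n with ⟨k, rfl | rfl⟩
  · have h := ww_form k
    refine ⟨k, 2^k, rfl, one_le_pow₀ (by norm_num), Or.inl ⟨h.1, h.2, ?_, ?_⟩⟩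
    · rw [ww_two, h.1]; ring
    · have : ww (2*k+3) = 2 * ww (2*k+1) := rfl
      rw [this, h.2]; ring
  · have h := ww_form k
    have h' := ww_form (k+1)
    refine ⟨k, 2^k, rfl, one_le_pow₀ (by norm_num), Or.inr ⟨h.2, ?_, ?_, ?_⟩⟩
    · have : ww (2*k+1+1) = 2 * ww (2*k) := rfl
      rw [this, h.1]; ring
    · have : ww (2*k+1+2) = 2 * ww (2*k+1) := rfl
      rw [this, h.2]; ring
    · have : ww (2*k+1+3) = 2 * (2 * ww (2*k)) := rfl
      rw [this, h.1]; ring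

theorem Oct_mono {n : ℕ} {x y : ℤ} (h : Oct n x y) : Oct (n+1) x y := by
  obtain ⟨k, K, -, hK, hw⟩ := ww_cases n
  unfold Oct at *
  have : ww (n+1+1) = ww (n+2) := rfl
  omega

theorem BB_even {n : ℕ} {u v : ℤ} : BB (n+1) (u - v) (u + v) ↔ BB n u v := by
  constructor
  · rintro (⟨h, -⟩ | ⟨u', v', h1, h2, h⟩)
    · omega
    · obtain rfl : u = u' := by omega
      obtain rfl : v = v' := by omega
      exact h
  · intro h
    exact Or.inr ⟨u, v, rfl, rfl, h⟩

theorem Oct_of_BB {n : ℕ} {x y : ℤ} (h : BB n x y) (ho : (x + y) % 2 = 1) : Oct n x y := by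
  cases n with
  | zero => simp only [BB] at h; simp only [Oct, ww]; omega
  | succ n =>
    rcases h with ⟨-, h⟩ | ⟨u, v, rfl, rfl, h⟩
    · exact h
    · omega

theorem BB_of_Oct {n : ℕ} {x y : ℤ} (h : Oct n x y) (ho : (x + y) % 2 = 1) : BB n x y := by
  cases n with
  | zero => simp only [Oct, ww] at h; simp only [BB]; omega
  | succ n => exact Or.inl ⟨ho, h⟩

theorem BB_zero (n : ℕ) : BB n 0 0 := by
  induction n with
  | zero => simp [BB]
  | succ n ih => exact Or.inr ⟨0, 0, by simp, by simp, ih⟩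

theorem BB_mono {n : ℕ} {x y : ℤ} (h : BB n x y) : BB (n+1) x y := by
  induction n generalizing x y with
  | zero =>
    by_cases ho : (x + y) % 2 = 1
    · exact BB_of_Oct (Oct_mono (Oct_of_BB h ho)) ho
    · simp only [BB] at h
      obtain rfl : x = 0 := by omega
      obtain rfl : y = 0 := by omega
      exact BB_zero 1
  | succ n ih =>
    rcases h with ⟨ho, h⟩ | ⟨u, v, rfl, rfl, h⟩
    · exact Or.inl ⟨ho, Oct_mono h⟩
    · exact Or.inr ⟨u, v, rfl, rfl, ih h⟩

theorem BB_rot {n : ℕ} {x y : ℤ} (h : BB n x y) : BB n (-y) x := by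
  induction n generalizing x y with
  | zero => simp only [BB] at *; omega
  | succ n ih =>
    rcases h with ⟨ho, h⟩ | ⟨u, v, rfl, rfl, h⟩
    · left; unfold Oct at *; omega
    · exact Or.inr ⟨-v, u, by ring, by ring, ih h⟩

theorem BB_conj {n : ℕ} {x y : ℤ} (h : BB n x y) : BB n x (-y) := by
  induction n generalizing x y with
  | zero => simp only [BB] at *; omega
  | succ n ih =>
    rcases h with ⟨ho, h⟩ | ⟨u, v, rfl, rfl, h⟩
    · left; unfold Oct at *; omega
    · refine Or.inr ⟨-v, -u, by ring, by ring, ?_⟩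
      have := BB_rot (BB_rot (BB_rot (ih h)))
      simpa using this

theorem even_split {x y : ℤ} (h : ¬ (x + y) % 2 = 1) : ∃ u v, x = u - v ∧ y = u + v :=
  ⟨(x + y) / 2, (y - x) / 2, by omega, by omega⟩

theorem BB_div {n : ℕ} {p q x y : ℤ} (h : BB n (p*x - q*y) (p*y + q*x))
    (h0 : ¬ (p*x - q*y = 0 ∧ p*y + q*x = 0)) : BB n x y := by
  induction n generalizing p q x y with
  | zero =>
    simp only [BB] at *
    set g := p*x - q*y with hg
    set k := p*y + q*x with hk
    have h1 : (p^2+q^2) * (x^2+y^2) = g^2 + k^2 := by rw [hg, hk]; ring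
    have h2 : g^2 + k^2 = 1 := by
      have : (g = 0 ∧ (k = 1 ∨ k = -1)) ∨ (k = 0 ∧ (g = 1 ∨ g = -1)) := by omega
      rcases this with ⟨h, h' | h'⟩ | ⟨h, h' | h'⟩ <;> rw [h, h'] <;> norm_num
    rw [h2] at h1
    have h3 : x^2 + y^2 = 1 := by
      rcases Int.mul_eq_one_iff_eq_one_or_neg_one.1 h1 with h | h
      · exact h.2
      · nlinarith [sq_nonneg x, sq_nonneg y]
    have hx : x ≤ 1 ∧ -1 ≤ x := by constructor <;> nlinarith [sq_nonneg x, sq_nonneg y]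
    have hy : y ≤ 1 ∧ -1 ≤ y := by constructor <;> nlinarith [sq_nonneg x, sq_nonneg y]
    obtain ⟨a1, a2⟩ := hx
    obtain ⟨a3, a4⟩ := hy
    clear hg hk h1
    interval_cases x <;> interval_cases y <;> simp_all
  | succ n ih =>
    by_cases hβ : (x + y) % 2 = 1
    swap
    · obtain ⟨u, v, rfl, rfl⟩ := even_split hβ
      rw [BB_even]
      have e1 : p * (u - v) - q * (u + v) = (p*u - q*v) - (p*v + q*u) := by ring
      have e2 : p * (u + v) + q * (u - v) = (p*u - q*v) + (p*v + q*u) := by ring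
      rw [e1, e2] at h h0
      rw [BB_even] at h
      exact ih h (by omega)
    by_cases hα : (p + q) % 2 = 1
    swap
    · obtain ⟨u, v, rfl, rfl⟩ := even_split hα
      have e1 : (u - v) * x - (u + v) * y = (u*x - v*y) - (u*y + v*x) := by ring
      have e2 : (u - v) * y + (u + v) * x = (u*x - v*y) + (u*y + v*x) := by ring
      rw [e1, e2] at h h0
      rw [BB_even] at h
      exact BB_mono (ih h (by omega))
    have ho : ((p*x - q*y) + (p*y + q*x)) % 2 = 1 := by
      have : (p*x - q*y) + (p*y + q*x) = (p + q) * (x + y) - 2 * (q * y) := by ring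
      rw [this]
      have h1 : ((p + q) * (x + y)) % 2 = 1 := by rw [Int.mul_emod, hα, hβ]; rfl
      omega
    have hO := Oct_of_BB h ho
    by_cases hN : 4 ≤ p^2 + q^2
    · refine BB_of_Oct ?_ hβ
      obtain ⟨k, K, -, hK, hw⟩ := ww_cases (n+1)
      unfold Oct at hO ⊢
      set g := p*x - q*y with hg
      set k := p*y + q*x with hk
      have h1 : (p^2+q^2) * (x^2+y^2) = g^2 + k^2 := by rw [hg, hk]; ring
      have hgb : g^2 ≤ (ww (n+1) - 2)^2 := sq_le_sq' (by omega) (by omega)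
      have hkb : k^2 ≤ (ww (n+1) - 2)^2 := sq_le_sq' (by omega) (by omega)
      have h2 : 4 * (x^2 + y^2) ≤ (p^2+q^2) * (x^2+y^2) := by
        apply mul_le_mul_of_nonneg_right hN; positivity
      have hs : (x + y)^2 ≤ (ww (n+1) - 2)^2 := by nlinarith [sq_nonneg (x - y)]
      have hd : (x - y)^2 ≤ (ww (n+1) - 2)^2 := by nlinarith [sq_nonneg (x + y)]
      have hs' := abs_le_of_sq_le_sq' hs (by omega)
      have hd' := abs_le_of_sq_le_sq' hd (by omega)
      have : ww (n+1+1) = ww (n+2) := rfl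
      clear hg hk
      omega
    · have hp : p ≤ 1 ∧ -1 ≤ p := by constructor <;> nlinarith [sq_nonneg p, sq_nonneg q]
      have hq : q ≤ 1 ∧ -1 ≤ q := by constructor <;> nlinarith [sq_nonneg p, sq_nonneg q]
      have : (p = 1 ∧ q = 0) ∨ (p = -1 ∧ q = 0) ∨ (p = 0 ∧ q = 1) ∨ (p = 0 ∧ q = -1) := by omega
      rcases this with ⟨rfl, rfl⟩ | ⟨rfl, rfl⟩ | ⟨rfl, rfl⟩ | ⟨rfl, rfl⟩
      · simpa using h
      · simpa using BB_rot (BB_rot h)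
      · simpa using BB_rot (BB_rot (BB_rot h))
      · simpa using BB_rot h

theorem target (n : ℕ) : ∃ s t : ℤ, (s + t) % 2 = 0 ∧
    (s ≤ ww (n+1) - ww n ∧ -s ≤ ww (n+1) - ww n ∧ t ≤ ww (n+1) - ww n ∧ -t ≤ ww (n+1) - ww n ∧
     s + t ≤ ww (n+2) - ww (n+1) ∧ s - t ≤ ww (n+2) - ww (n+1) ∧
     -s + t ≤ ww (n+2) - ww (n+1) ∧ -s - t ≤ ww (n+2) - ww (n+1)) ∧
    ∀ x y, BB n x y → BB (n+1) (s - x) (t - y) ∧ ¬ (s - x = 0 ∧ t - y = 0) := by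
  have main : ∀ (n : ℕ) (s t : ℤ), (s + t) % 2 = 0 →
      (s ≤ ww (n+1) - ww n ∧ -s ≤ ww (n+1) - ww n ∧ t ≤ ww (n+1) - ww n ∧ -t ≤ ww (n+1) - ww n ∧
     s + t ≤ ww (n+2) - ww (n+1) ∧ s - t ≤ ww (n+2) - ww (n+1) ∧
     -s + t ≤ ww (n+2) - ww (n+1) ∧ -s - t ≤ ww (n+2) - ww (n+1)) →
      ∀ x y, (x + y) % 2 = 1 → BB n x y →
        BB (n+1) (s - x) (t - y) ∧ ¬ (s - x = 0 ∧ t - y = 0) := by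
    intro n s t hp hb x y ho h
    have hO := Oct_of_BB h ho
    refine ⟨BB_of_Oct ?_ (by omega), by omega⟩
    unfold Oct at *
    have : ww (n+1+1) = ww (n+2) := rfl
    omega
  induction n with
  | zero =>
    have hb : ((1:ℤ) ≤ ww (0+1) - ww 0 ∧ -(1:ℤ) ≤ ww (0+1) - ww 0 ∧ (1:ℤ) ≤ ww (0+1) - ww 0 ∧
      -(1:ℤ) ≤ ww (0+1) - ww 0 ∧
     (1:ℤ) + 1 ≤ ww (0+2) - ww (0+1) ∧ (1:ℤ) - 1 ≤ ww (0+2) - ww (0+1) ∧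
     -(1:ℤ) + 1 ≤ ww (0+2) - ww (0+1) ∧ -(1:ℤ) - 1 ≤ ww (0+2) - ww (0+1)) := by simp [ww]
    refine ⟨1, 1, by norm_num, hb, ?_⟩
    intro x y h
    by_cases ho : (x + y) % 2 = 1
    · exact main 0 1 1 (by norm_num) hb x y ho h
    · simp only [BB] at h
      obtain rfl : x = 0 := by omega
      obtain rfl : y = 0 := by omega
      refine ⟨Or.inr ⟨1, 0, by norm_num, by norm_num, by simp [BB]⟩, by norm_num⟩
  | succ n ih =>
    obtain ⟨s, t, hp, hb, H⟩ := ih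
    have hb' : ((s - t) ≤ ww (n+1+1) - ww (n+1) ∧ -(s - t) ≤ ww (n+1+1) - ww (n+1) ∧
      (s + t) ≤ ww (n+1+1) - ww (n+1) ∧ -(s + t) ≤ ww (n+1+1) - ww (n+1) ∧
     (s - t) + (s + t) ≤ ww (n+1+2) - ww (n+1+1) ∧ (s - t) - (s + t) ≤ ww (n+1+2) - ww (n+1+1) ∧
     -(s - t) + (s + t) ≤ ww (n+1+2) - ww (n+1+1) ∧
     -(s - t) - (s + t) ≤ ww (n+1+2) - ww (n+1+1)) := by
      have e1 : ww (n+1+1) = ww (n+2) := rfl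
      have e2 : ww (n+1+2) = 2 * ww (n+1) := rfl
      have e3 := ww_two n
      omega
    refine ⟨s - t, s + t, by omega, hb', ?_⟩
    intro x y h
    by_cases ho : (x + y) % 2 = 1
    · exact main (n+1) _ _ (by omega) hb' x y ho h
    · obtain ⟨u, v, rfl, rfl⟩ := even_split ho
      rw [BB_even] at h
      obtain ⟨h1, h2⟩ := H u v h
      have e1 : s - t - (u - v) = (s - u) - (t - v) := by ring
      have e2 : s + t - (u + v) = (s - u) + (t - v) := by ring
      rw [e1, e2, BB_even]
      exact ⟨h1, by omega⟩

/-- A sufficient closed-form condition for membership. -/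
theorem BB_of_forall {n : ℕ} {x y : ℤ} (h : ∀ j : ℕ, (2:ℤ)^j ∣ x → (2:ℤ)^j ∣ y →
    x ≤ ww n - 2 * 2^j ∧ -x ≤ ww n - 2 * 2^j ∧ y ≤ ww n - 2 * 2^j ∧ -y ≤ ww n - 2 * 2^j ∧
    x + y ≤ ww (n+1) - 3 * 2^j ∧ x - y ≤ ww (n+1) - 3 * 2^j ∧
    -x + y ≤ ww (n+1) - 3 * 2^j ∧ -x - y ≤ ww (n+1) - 3 * 2^j) : BB n x y := by
  induction n using Nat.strong_induction_on generalizing x y with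
  | _ n ih =>
  have h0 := h 0 (by simp) (by simp)
  simp only [pow_zero, mul_one] at h0
  have hO : Oct n x y := by unfold Oct; omega
  by_cases ho : (x + y) % 2 = 1
  · exact BB_of_Oct hO ho
  match n, ih, h, h0, hO with
  | 0, _, _, h0, _ => simp only [ww] at h0; simp only [BB]; omega
  | 1, _, h, h0, _ =>
    simp only [ww] at h0
    obtain ⟨u, v, rfl, rfl⟩ := even_split ho
    rw [BB_even]
    by_cases hu : (u - v) % 2 = 0
    · have h1 := h 1 (by simp; omega) (by simp; omega)
      simp only [ww] at h1; simp only [BB]; omega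
    · simp only [BB]; omega
  | m + 2, ih, h, h0, hO =>
    obtain ⟨u, v, rfl, rfl⟩ := even_split ho
    rw [BB_even]
    obtain ⟨k, K, -, hK, hw⟩ := ww_cases m
    have e2 : ww (m+2+1) = ww (m+3) := rfl
    have e3 : ww (m+1+1) = ww (m+2) := rfl
    by_cases ho2 : (u + v) % 2 = 1
    · apply BB_of_Oct _ ho2
      unfold Oct at *
      omega
    · obtain ⟨s, t, rfl, rfl⟩ := even_split ho2
      rw [BB_even]
      apply ih m (by omega)
      intro j hs ht
      have h1 := h (j+1) (by rw [pow_succ]; obtain ⟨c, hc⟩ := ht; exact ⟨-c, by rw [hc]; ring⟩)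
        (by rw [pow_succ]; obtain ⟨c, hc⟩ := hs; exact ⟨c, by rw [hc]; ring⟩)
      rw [pow_succ] at h1
      omega

theorem dvd_gap {J u t : ℤ} (hu : J ∣ u) (ht : J ∣ t) (h : t - J < u) : t ≤ u := by
  obtain ⟨a, rfl⟩ := hu
  obtain ⟨b, rfl⟩ := ht
  by_contra hc
  rcases le_or_gt J 0 with hJ | hJ
  · omega
  · have h1 : a < b := by
      by_contra h2
      exact hc (mul_le_mul_of_nonneg_left (by omega) hJ.le)
    have : J * (a + 1) ≤ J * b := mul_le_mul_of_nonneg_left (by omega) hJ.le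
    rw [mul_add] at this
    omega

theorem core {n : ℕ} {a b x y : ℤ} (hb : 0 ≤ b) (hab : b < a) (hodd : (a + b) % 2 = 1)
    (hO : Oct (n+1) a b) (hxy : y ≤ x) (hxy' : -y ≤ x) (hx : 2 * x ≤ a + b)
    (hs : x + y < a) (hd : x - y < a) :
    BB n x y ∨ ((x + y) % 2 = 0 ∧ (Oct n (x - a) (y - b) ∨ Oct n (x - b) (y + a))) := by
  obtain ⟨k, K, hKk, hK, hw⟩ := ww_cases n
  have e1 : ww (n+1+1) = ww (n+2) := rfl
  have hOz : Oct n x y := by unfold Oct at *; omega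
  by_cases ho : (x + y) % 2 = 1
  · exact Or.inl (BB_of_Oct hOz ho)
  by_cases hB : BB n x y
  · exact Or.inl hB
  refine Or.inr ⟨by omega, ?_⟩
  have hz0 : 0 < x := by
    by_contra hc
    obtain rfl : x = 0 := by omega
    obtain rfl : y = 0 := by omega
    exact hB (BB_zero n)
  have hj : ∃ j : ℕ, (2:ℤ)^j ∣ x ∧ (2:ℤ)^j ∣ y ∧ (ww n - 2 * 2^j < x ∨
      ww (n+1) - 3 * 2^j < x + y ∨ ww (n+1) - 3 * 2^j < x - y) := by
    by_contra hc
    push Not at hc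
    apply hB
    apply BB_of_forall
    intro j h1 h2
    have := hc j h1 h2
    have hp : (0:ℤ) < 2^j := by positivity
    omega
  obtain ⟨j, hjx, hjy, hv⟩ := hj
  have hJle := Int.le_of_dvd hz0 hjx
  have hJ1 : (2:ℤ)^j ≠ 1 := by
    intro h; rw [h] at hv; unfold Oct at hOz; omega
  have hJ2 : (2:ℤ) ≤ 2^j := by
    have hp : (0:ℤ) < 2^j := by positivity
    omega
  have hcase : (2:ℤ)^j ∣ K ∨ (2:ℤ)^j = 2 * K ∨ 4 * K ≤ (2:ℤ)^j := by
    rcases Nat.lt_trichotomy j (k+1) with h | h | h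
    · left; rw [hKk]; exact pow_dvd_pow 2 (by omega)
    · right; left; rw [h, hKk, pow_succ]; ring
    · right; right
      have : (2:ℤ)^(k+2) ≤ 2^j := pow_le_pow_right₀ (by norm_num) (by omega)
      rw [pow_add] at this
      omega
  generalize (2:ℤ)^j = J at *
  have big : ∀ W W' : ℤ, ww n = W → ww (n+1) = W' → J ∣ W → J ∣ W' → J ≤ W' - W →
      J ≤ 2 * W - W' → (2 * J ≤ 2 * W - W' ∨ W' - W ≤ J) → W' % 2 = 0 → ww (n+2) = 2 * W →
      Oct n (x - a) (y - b) ∨ Oct n (x - b) (y + a) := by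
    intro W W' hW hW' dW dW' hl1 hl2 hl3 hpar hW2
    have g1 : W - 2 * J < x → W - J ≤ x := fun h =>
      dvd_gap hjx (dvd_sub dW (dvd_refl J)) (by omega)
    have g2 : W' - 3 * J < x + y → W' - 2 * J ≤ x + y := fun h =>
      dvd_gap (dvd_add hjx hjy) (dvd_sub dW' (dvd_mul_left J 2)) (by omega)
    have g3 : W' - 3 * J < x - y → W' - 2 * J ≤ x - y := fun h =>
      dvd_gap (dvd_sub hjx hjy) (dvd_sub dW' (dvd_mul_left J 2)) (by omega)
    have g4 : x + J ≤ W := dvd_gap dW (dvd_add hjx (dvd_refl J)) (by unfold Oct at hOz; omega)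
    have g5 : W' - W - J < -y → W' - W ≤ -y := fun h =>
      dvd_gap (dvd_neg.2 hjy) (dvd_sub dW' dW) h
    rw [hW, hW'] at hv
    clear hjx hjy dW dW' hw hKk hK hcase hB hJ1
    unfold Oct at *
    have hv' : W - J ≤ x ∨ W' - 2 * J ≤ x + y ∨ W' - 2 * J ≤ x - y := by omega
    clear hv g1 g2 g3
    rcases le_or_gt 0 y with hy | hy
    · left
      rcases hv' with hv | hv | hv <;> omega
    · by_cases hc : a + y ≤ W - 2
      · by_cases hc1 : y - b ≥ -(W - 2) ∧ a + b - x - y ≤ W' - 3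
        · left
          rcases hv' with hv | hv | hv <;> omega
        · right
          rcases le_or_gt b x with hbx | hbx
          · rcases hv' with hv | hv | hv <;> omega
          · rcases hv' with hv | hv | hv <;> omega
      · left
        rcases hv' with hv | hv | hv <;> omega
  rcases hw with ⟨w0, w1, w2, -⟩ | ⟨w0, w1, w2, -⟩
  · rcases hcase with h | h | h
    · have := Int.le_of_dvd (by omega) h
      exact big _ _ w0 w1 (h.mul_left _) (h.mul_left _) (by omega) (by omega) (by omega)
        (by omega) (by omega)
    · have hx2 : x ≤ 2 * K := by
        by_contra hc
        have := dvd_gap hjx (dvd_mul_left J 2) (by omega)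
        unfold Oct at hOz
        omega
      have hy0 : y = 0 := by
        by_contra hc
        have := Int.le_of_dvd (abs_pos.2 hc) ((dvd_abs _ _).2 hjy)
        unfold Oct at hOz
        rcases abs_cases y with h | h <;> omega
      left
      clear hjx hjy big hB
      unfold Oct at *
      omega
    · unfold Oct at hOz; omega
  · rcases hcase with h | h | h
    · have := Int.le_of_dvd (by omega) h
      exact big _ _ w0 w1 (h.mul_left _) (h.mul_left _) (by omega) (by omega) (by omega)
        (by omega) (by omega)
    · exact big _ _ w0 w1 ⟨2, by rw [h]; ring⟩ ⟨3, by rw [h]; ring⟩ (by omega) (by omega) (by omega)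
        (by omega) (by omega)
    · unfold Oct at hOz; omega

def Cov (n : ℕ) (β : GaussianInt) : Prop :=
  ∀ x : GaussianInt, ∃ r : GaussianInt, BB n r.re r.im ∧ β ∣ x - r

def gI : GaussianInt := ⟨0, 1⟩

theorem gI_sq : gI * gI = -1 := by
  ext <;> simp [gI]

theorem gI_unit : IsUnit gI :=
  IsUnit.of_mul_eq_one (-gI) (by rw [mul_neg, gI_sq, neg_neg])

theorem gI_mul (z : GaussianInt) : gI * z = ⟨-z.im, z.re⟩ := by
  ext <;> simp [gI]

theorem BB_gI {n : ℕ} {z : GaussianInt} (h : BB n z.re z.im) :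
    BB n (gI * z).re (gI * z).im := by
  rw [gI_mul]; exact BB_rot h

theorem Cov_rot {n : ℕ} {β : GaussianInt} (h : Cov n (gI * β)) : Cov n β := by
  intro x
  obtain ⟨r, hr, hd⟩ := h x
  exact ⟨r, hr, (dvd_mul_left β gI).trans hd⟩

theorem Cov_star {n : ℕ} {β : GaussianInt} (h : Cov n (star β)) : Cov n β := by
  intro x
  obtain ⟨r, hr, c, hc⟩ := h (star x)
  refine ⟨star r, by simpa using BB_conj hr, star c, ?_⟩
  have := congrArg star hc
  simpa [mul_comm] using this

/-- rotate a Gaussian integer into the sector `|im| ≤ re`. -/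
theorem rot_sector (P : GaussianInt → Prop) (hP : ∀ z, P (gI * z) → P z)
    (h : ∀ z : GaussianInt, z.im ≤ z.re → -z.im ≤ z.re → P z) (z : GaussianInt) : P z := by
  have h1 := gI_mul z
  have h2 := gI_mul (gI * z)
  have h3 := gI_mul (gI * (gI * z))
  by_cases c1 : z.im ≤ z.re <;> by_cases c2 : -z.im ≤ z.re
  · exact h z c1 c2
  · apply hP
    apply h <;> rw [h1] <;> simp <;> omega
  · apply hP
    apply hP
    apply hP
    apply h <;> rw [h3, h2, h1] <;> simp <;> omega
  · apply hP
    apply hP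
    apply h <;> rw [h2, h1] <;> simp <;> omega

theorem round_ex (p N : ℤ) (hN : 0 < N) (ho : N % 2 = 1) :
    ∃ q, 2 * (p - N * q) ≤ N - 1 ∧ -(2 * (p - N * q)) ≤ N - 1 := by
  have h1 := Int.emod_add_mul_ediv p N
  have h2 := Int.emod_nonneg p hN.ne'
  have h3 := Int.emod_lt_of_pos p hN
  by_cases h : 2 * (p % N) ≤ N - 1
  · refine ⟨p / N, ?_, ?_⟩ <;> omega
  · refine ⟨p / N + 1, ?_, ?_⟩ <;> rw [mul_add] <;> omega

theorem reduce_ex (β x : GaussianInt) (hb : 0 ≤ β.im) (hab : β.im < β.re)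
    (hodd : (β.re + β.im) % 2 = 1) : ∃ z : GaussianInt, β ∣ x - z ∧
      2 * z.re ≤ β.re + β.im ∧ -(2 * z.re) ≤ β.re + β.im ∧
      2 * z.im ≤ β.re + β.im ∧ -(2 * z.im) ≤ β.re + β.im ∧
      z.re + z.im < β.re ∧ z.re - z.im < β.re ∧ -z.re + z.im < β.re ∧ -z.re - z.im < β.re := by
  obtain ⟨a, b⟩ := β
  obtain ⟨s, t⟩ := x
  simp only at hb hab hodd
  have hN : 0 < a^2 + b^2 := by nlinarith
  have hNo : (a^2 + b^2) % 2 = 1 := by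
    have : a^2 + b^2 = (a + b) * (a + b) - 2 * (a * b) := by ring
    rw [this]
    have h1 : ((a + b) * (a + b)) % 2 = 1 := by rw [Int.mul_emod, hodd]; rfl
    omega
  obtain ⟨q1, hq1, hq1'⟩ := round_ex (a*s + b*t) _ hN hNo
  obtain ⟨q2, hq2, hq2'⟩ := round_ex (a*t - b*s) _ hN hNo
  refine ⟨⟨s, t⟩ - ⟨a, b⟩ * ⟨q1, q2⟩, ⟨⟨q1, q2⟩, by ring⟩, ?_⟩
  simp only [Zsqrtd.re_sub, Zsqrtd.im_sub, Zsqrtd.re_mul, Zsqrtd.im_mul]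
  generalize hX : s - (a * q1 + -1 * b * q2) = X
  generalize hY : t - (a * q2 + b * q1) = Y
  have hP : a * X + b * Y = a*s + b*t - (a^2+b^2) * q1 := by rw [← hX, ← hY]; ring
  have hQ : a * Y - b * X = a*t - b*s - (a^2+b^2) * q2 := by rw [← hX, ← hY]; ring
  rw [← hP] at hq1 hq1'
  rw [← hQ] at hq2 hq2'
  clear hP hQ hX hY hNo
  generalize hNN : a^2 + b^2 = N at *
  generalize hP : a * X + b * Y = P at *
  generalize hQ : a * Y - b * X = Q at *
  have eX : X * N = a * P - b * Q := by rw [← hP, ← hQ, ← hNN]; ring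
  have eY : Y * N = a * Q + b * P := by rw [← hP, ← hQ, ← hNN]; ring
  have ha : 0 < a := by omega
  have hd : 0 < a - b := by omega
  have b1 := mul_le_mul_of_nonneg_left hq1 ha.le
  have b2 := mul_le_mul_of_nonneg_left hq1' ha.le
  have b3 := mul_le_mul_of_nonneg_left hq2 ha.le
  have b4 := mul_le_mul_of_nonneg_left hq2' ha.le
  have c1 := mul_le_mul_of_nonneg_left hq1 hb
  have c2 := mul_le_mul_of_nonneg_left hq1' hb
  have c3 := mul_le_mul_of_nonneg_left hq2 hb
  have c4 := mul_le_mul_of_nonneg_left hq2' hb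
  have d1 := mul_le_mul_of_nonneg_left hq1 hd.le
  have d2 := mul_le_mul_of_nonneg_left hq1' hd.le
  have d3 := mul_le_mul_of_nonneg_left hq2 hd.le
  have d4 := mul_le_mul_of_nonneg_left hq2' hd.le
  refine ⟨?_, ?_, ?_, ?_, ?_, ?_, ?_, ?_⟩
  all_goals
    first
    | apply le_of_mul_le_mul_right _ hN
      linarith
    | apply lt_of_mul_lt_mul_right _ hN.le
      linarith

theorem Cov_odd_aux {n : ℕ} {β : GaussianInt} (hb : 0 ≤ β.im) (hab : β.im < β.re)
    (hodd : (β.re + β.im) % 2 = 1) (hO : Oct (n+1) β.re β.im) : Cov n β := by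
  intro x
  obtain ⟨z, hz, hbd⟩ := reduce_ex β x hb hab hodd
  suffices h : ∃ r : GaussianInt, BB n r.re r.im ∧ β ∣ z - r by
    obtain ⟨r, hr, hd⟩ := h
    exact ⟨r, hr, by simpa using dvd_add hz hd⟩
  clear hz
  revert hbd
  refine rot_sector (fun z => (2 * z.re ≤ β.re + β.im ∧ -(2 * z.re) ≤ β.re + β.im ∧
      2 * z.im ≤ β.re + β.im ∧ -(2 * z.im) ≤ β.re + β.im ∧
      z.re + z.im < β.re ∧ z.re - z.im < β.re ∧ -z.re + z.im < β.re ∧ -z.re - z.im < β.re) →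
      ∃ r : GaussianInt, BB n r.re r.im ∧ β ∣ z - r) ?_ ?_ z
  · intro z ih hbd
    obtain ⟨r, hr, hd⟩ := ih (by rw [gI_mul]; simp only; omega)
    refine ⟨gI * (gI * (gI * r)), BB_gI (BB_gI (BB_gI hr)), ?_⟩
    have : z - gI * (gI * (gI * r)) = -gI * (gI * z - r) := by
      linear_combination (z - gI * r) * gI_sq
    rw [this]
    exact hd.mul_left _
  · intro z h1 h2 hbd
    rcases core hb hab hodd hO h1 h2 hbd.1 hbd.2.2.2.2.1 hbd.2.2.2.2.2.1 with h | ⟨he, h | h⟩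
    · exact ⟨z, h, by simp⟩
    · exact ⟨z - β, BB_of_Oct (by simpa using h) (by simp; omega), by simp⟩
    · refine ⟨z + gI * β, BB_of_Oct ?_ ?_, by simp⟩
      · rw [gI_mul]; simpa [sub_eq_add_neg] using h
      · rw [gI_mul]; simp; omega

theorem Cov_odd {n : ℕ} (β : GaussianInt) (hodd : (β.re + β.im) % 2 = 1)
    (hO : Oct (n+1) β.re β.im) : Cov n β := by
  revert hodd hO
  refine rot_sector (fun β => (β.re + β.im) % 2 = 1 → Oct (n+1) β.re β.im → Cov n β) ?_ ?_ β
  · intro z ih ho hO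
    apply Cov_rot
    apply ih
    · rw [gI_mul]; simp only; omega
    · rw [gI_mul]; unfold Oct at *; simp only; omega
  · intro β h1 h2 ho hO
    rcases le_or_gt 0 β.im with h | h
    · exact Cov_odd_aux h (by omega) ho hO
    · apply Cov_star
      apply Cov_odd_aux
      · simp; omega
      · simp; omega
      · simp; omega
      · simp; unfold Oct at *; omega

def g1I : GaussianInt := ⟨1, 1⟩

theorem g1I_mul (z : GaussianInt) : g1I * z = ⟨z.re - z.im, z.re + z.im⟩ := by
  ext <;> simp [g1I] <;> ring

theorem odd_one_add {n : ℕ} {u v : ℤ} (h : BB n u v) : BB (n+1) (u - v + 1) (u + v) := by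
  apply BB_of_Oct _ (by omega)
  have hO : Oct n u v ∨ (u = 0 ∧ v = 0) := by
    induction n generalizing u v with
    | zero => simp only [BB] at h; simp only [Oct, ww]; omega
    | succ n ih =>
      rcases h with ⟨-, h⟩ | ⟨x, y, rfl, rfl, h⟩
      · exact Or.inl h
      · rcases ih h with h | h
        · left
          obtain ⟨k, K, -, hK, hw⟩ := ww_cases n
          have : ww (n+1+1) = ww (n+2) := rfl
          unfold Oct at *
          omega
        · right; omega
  obtain ⟨k, K, -, hK, hw⟩ := ww_cases n
  have : ww (n+1+1) = ww (n+2) := rfl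
  unfold Oct at *
  omega

theorem cover (n : ℕ) (β : GaussianInt) (h0 : β ≠ 0) (h : BB (n+1) β.re β.im) : Cov n β := by
  induction n generalizing β with
  | zero =>
    rcases h with ⟨ho, hO⟩ | ⟨u, v, hu, hv, h⟩
    · exact Cov_odd β ho hO
    · obtain rfl : β = g1I * ⟨u, v⟩ := by rw [g1I_mul]; ext <;> simp [hu, hv]
      have hun : IsUnit (⟨u, v⟩ : GaussianInt) := by
        have huv : ¬ (u = 0 ∧ v = 0) := by
          rintro ⟨rfl, rfl⟩
          exact h0 (by rw [g1I_mul]; ext <;> simp)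
        simp only [BB] at h
        have h2 : (u = 0 ∧ (v = 1 ∨ v = -1)) ∨ (v = 0 ∧ (u = 1 ∨ u = -1)) := by omega
        rw [← Zsqrtd.norm_eq_one_iff]
        rcases h2 with ⟨rfl, rfl | rfl⟩ | ⟨rfl, rfl | rfl⟩ <;> simp [Zsqrtd.norm]
      intro x
      by_cases hx : (x.re + x.im) % 2 = 1
      · obtain ⟨s, t, hs, ht⟩ := even_split (x := x.re - 1) (y := x.im) (by omega)
        refine ⟨1, by simp [BB], ?_⟩
        rw [hun.mul_right_dvd]
        refine ⟨⟨s, t⟩, ?_⟩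
        rw [g1I_mul]
        ext <;> simp <;> omega
      · obtain ⟨s, t, hs, ht⟩ := even_split hx
        refine ⟨0, by simp [BB], ?_⟩
        rw [hun.mul_right_dvd]
        refine ⟨⟨s, t⟩, ?_⟩
        rw [g1I_mul]
        ext <;> simp <;> omega
  | succ n ih =>
    rcases h with ⟨ho, hO⟩ | ⟨u, v, hu, hv, h⟩
    · exact Cov_odd β ho hO
    · obtain rfl : β = g1I * ⟨u, v⟩ := by rw [g1I_mul]; ext <;> simp [hu, hv]
      have hc := ih ⟨u, v⟩ (by rintro h; exact h0 (by rw [h, mul_zero])) h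
      intro x
      by_cases hx : (x.re + x.im) % 2 = 1
      · obtain ⟨s, t, hs, ht⟩ := even_split (x := x.re - 1) (y := x.im) (by omega)
        obtain ⟨r, hr, hd⟩ := hc ⟨s, t⟩
        refine ⟨g1I * r + 1, ?_, ?_⟩
        · rw [g1I_mul]; simpa using odd_one_add hr
        · have : x - (g1I * r + 1) = g1I * (⟨s, t⟩ - r) := by
            rw [g1I_mul, g1I_mul]
            ext <;> simp <;> omega
          rw [this]
          exact mul_dvd_mul_left _ hd
      · obtain ⟨s, t, hs, ht⟩ := even_split hx
        obtain ⟨r, hr, hd⟩ := hc ⟨s, t⟩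
        refine ⟨g1I * r, ?_, ?_⟩
        · rw [g1I_mul]; exact BB_even.2 hr
        · have : x - g1I * r = g1I * (⟨s, t⟩ - r) := by
            rw [g1I_mul, g1I_mul]
            ext <;> simp <;> omega
          rw [this]
          exact mul_dvd_mul_left _ hd

theorem motzkin_iff (n : ℕ) (z : GaussianInt) : z ∈ MotzkinSet n ↔ BB n z.re z.im := by
  induction n generalizing z with
  | zero =>
    obtain ⟨u, v⟩ := z
    simp only [MotzkinSet, Set.mem_ofPred_eq, BB]
    constructor
    · rintro (h | h)
      · have h1 := congrArg Zsqrtd.re h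
        have h2 := congrArg Zsqrtd.im h
        simp at h1 h2
        omega
      · rw [← Zsqrtd.norm_eq_one_iff' (by norm_num)] at h
        simp only [Zsqrtd.norm] at h
        have hx : u ≤ 1 ∧ -1 ≤ u := by constructor <;> nlinarith [sq_nonneg u, sq_nonneg v]
        have hy : v ≤ 1 ∧ -1 ≤ v := by constructor <;> nlinarith [sq_nonneg u, sq_nonneg v]
        obtain ⟨a1, a2⟩ := hx
        obtain ⟨a3, a4⟩ := hy
        interval_cases u <;> interval_cases v <;> simp_all
    · intro h
      by_cases huv : u = 0 ∧ v = 0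
      · left; ext <;> simp [huv]
      · right
        have h2 : (u = 0 ∧ (v = 1 ∨ v = -1)) ∨ (v = 0 ∧ (u = 1 ∨ u = -1)) := by omega
        rw [← Zsqrtd.norm_eq_one_iff]
        rcases h2 with ⟨rfl, rfl | rfl⟩ | ⟨rfl, rfl | rfl⟩ <;> simp [Zsqrtd.norm]
  | succ n ih =>
    simp only [MotzkinSet, Set.mem_union, Set.mem_ofPred_eq]
    constructor
    · rintro (h | h)
      · exact BB_mono ((ih z).1 h)
      · obtain ⟨s, t, -, -, H⟩ := target n
        obtain ⟨r, hr, c, hc⟩ := h ⟨s, t⟩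
        obtain ⟨h1, h2⟩ := H _ _ ((ih r).1 hr)
        have e1 := congrArg Zsqrtd.re hc
        have e2 := congrArg Zsqrtd.im hc
        simp only [Zsqrtd.re_sub, Zsqrtd.im_sub, Zsqrtd.re_mul, Zsqrtd.im_mul] at e1 e2
        have e1' : s - r.re = c.re * z.re - c.im * z.im := by rw [e1]; ring
        have e2' : t - r.im = c.re * z.im + c.im * z.re := by rw [e2]; ring
        rw [e1', e2'] at h1 h2
        exact BB_div h1 h2
    · intro h
      by_cases h0 : z = 0
      · left; rw [ih, h0]; exact BB_zero n
      · right
        intro x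
        obtain ⟨r, hr, hd⟩ := cover n z h0 h x
        exact ⟨r, (ih r).2 hr, hd⟩

theorem motzkin_mono {m n : ℕ} (h : m ≤ n) : MotzkinSet m ⊆ MotzkinSet n := by
  induction n, h using Nat.le_induction with
  | base => exact subset_rfl
  | succ n _ ih => exact ih.trans (fun z hz => Or.inl hz)

def OddOct (n : ℕ) : Set GaussianInt := {z | (z.re + z.im) % 2 = 1 ∧ Oct n z.re z.im}

theorem motzkin_succ (n : ℕ) :
    MotzkinSet (n+1) = OddOct (n+1) ∪ (fun z => g1I * z) '' MotzkinSet n := by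
  ext z
  rw [motzkin_iff]
  constructor
  · rintro (h | ⟨u, v, hu, hv, h⟩)
    · exact Or.inl h
    · refine Or.inr ⟨⟨u, v⟩, (motzkin_iff _ _).2 h, ?_⟩
      simp only [g1I_mul]
      ext <;> simp [hu, hv]
  · rintro (h | ⟨r, hr, rfl⟩)
    · exact Or.inl h
    · rw [motzkin_iff] at hr
      simp only [g1I_mul]
      exact BB_even.2 hr

theorem g1I_inj : Function.Injective (fun z => g1I * z) := by
  intro a b h
  simp only [g1I_mul] at h
  have h1 := congrArg Zsqrtd.re h
  have h2 := congrArg Zsqrtd.im h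
  simp only at h1 h2
  ext <;> omega

/-- counting a square with four corner triangles cut off -/
theorem count_sum (M L : ℕ) (h : 2 * L ≤ M) :
    (∑ p ∈ Finset.range M, ((M : ℤ) - 2 * (((L - p : ℕ) : ℤ) + ((L - (M - 1 - p) : ℕ) : ℤ)))) =
      (M : ℤ)^2 - 2 * (L * (L + 1)) := by
  have tri : ∀ M : ℕ, L ≤ M → 2 * ∑ p ∈ Finset.range M, ((L - p : ℕ) : ℤ) = L * (L + 1) := by
    intro M hM
    induction M, hM using Nat.le_induction with
    | base =>
      clear h
      induction L with
      | zero => simp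
      | succ L ih =>
        rw [Finset.sum_range_succ']
        simp only [Nat.add_sub_add_right]
        rw [mul_add, ih]
        push_cast
        ring
    | succ n hn ih =>
      rw [Finset.sum_range_succ, mul_add, ih, Nat.sub_eq_zero_of_le hn]
      simp
  have h1 := tri M (by omega)
  have h2 := Finset.sum_range_reflect (fun p => ((L - p : ℕ) : ℤ)) M
  rw [Finset.sum_sub_distrib, ← Finset.mul_sum, Finset.sum_add_distrib, h2]
  simp
  linarith

theorem oddOct_card (n M L : ℕ) (hM : ww (n+1) = M + 2) (hL : ww (n+1) - ww n - 1 = L)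
    (hLM : 2 * L ≤ M) (hMe : M % 2 = 0) (hpos : 0 < M) :
    (OddOct n).Finite ∧ ((OddOct n).ncard : ℤ) = (M : ℤ)^2 - 2 * (L * (L + 1)) := by
  let l : ℕ → ℕ := fun p => (L - p) + (L - (M - 1 - p))
  let S : Finset (Σ _ : ℕ, ℕ) := (Finset.range M).sigma (fun p => Finset.Ico (l p) (M - l p))
  let f : (Σ _ : ℕ, ℕ) → GaussianInt := fun x => ⟨x.1 + x.2 - (M - 1), x.1 - x.2⟩
  have hf : Function.Injective f := by
    rintro ⟨a, b⟩ ⟨c, d⟩ h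
    have h1 := congrArg Zsqrtd.re h
    have h2 := congrArg Zsqrtd.im h
    simp only [f] at h1 h2
    obtain rfl : a = c := by omega
    obtain rfl : b = d := by omega
    rfl
  have hS : OddOct n = f '' (S : Set (Σ _ : ℕ, ℕ)) := by
    ext ⟨x, y⟩
    simp only [OddOct, Oct, Set.mem_ofPred_eq, Set.mem_image, Finset.mem_coe, S, Finset.mem_sigma,
      Finset.mem_range, Finset.mem_Ico, f, l]
    constructor
    · rintro ⟨ho, hO⟩
      refine ⟨⟨((x + y + (M - 1)) / 2).toNat, ((x - y + (M - 1)) / 2).toNat⟩, ?_, ?_⟩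
      · simp only
        omega
      · ext <;> simp only <;> omega
    · rintro ⟨⟨p, q⟩, ⟨h1, h2, h3⟩, h⟩
      have e1 := congrArg Zsqrtd.re h
      have e2 := congrArg Zsqrtd.im h
      simp only at e1 e2 h1 h2 h3
      omega
  refine ⟨by rw [hS]; exact (Finset.finite_toSet S).image f, ?_⟩
  rw [hS, Set.ncard_image_of_injective _ hf, Set.ncard_coe_finset, Finset.card_sigma]
  push_cast
  rw [← count_sum M L hLM]
  apply Finset.sum_congr rfl
  intro p hp
  rw [Finset.mem_range] at hp
  rw [Nat.card_Ico]
  simp only [l]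
  omega

theorem fiber_card (n : ℕ) (hfin : ∀ m, (OddOct (m+1)).Finite) :
    {z : GaussianInt | phi z = n + 1}.ncard = (OddOct (n+1)).ncard := by
  have fin : ∀ m, (MotzkinSet m).Finite := by
    intro m
    induction m with
    | zero =>
      apply Set.Finite.subset ((hfin 0).union (Set.finite_singleton 0))
      intro z hz
      rw [motzkin_iff] at hz
      by_cases ho : (z.re + z.im) % 2 = 1
      · exact Or.inl ⟨ho, Oct_of_BB (BB_mono hz) ho⟩
      · right
        simp only [BB] at hz
        show z = 0
        ext <;> simp <;> omega
    | succ m ih =>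
      rw [motzkin_succ]
      exact (hfin m).union (ih.image _)
  have hcard : (MotzkinSet (n+1)).ncard = (OddOct (n+1)).ncard + (MotzkinSet n).ncard := by
    rw [motzkin_succ, Set.ncard_union_eq _ (hfin n) ((fin n).image _),
      Set.ncard_image_of_injective _ g1I_inj]
    rw [Set.disjoint_left]
    rintro z ⟨ho, -⟩ ⟨r, -, rfl⟩
    simp only [g1I_mul] at ho
    omega
  have hfib : {z : GaussianInt | phi z = n + 1} = MotzkinSet (n+1) \ MotzkinSet n := by
    ext z
    simp only [Set.mem_ofPred_eq, Set.mem_sdiff, phi]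
    constructor
    · intro h
      constructor
      · have := Nat.sInf_mem (Nat.nonempty_of_sInf_eq_succ h)
        rw [h] at this
        exact this
      · intro hz
        have := Nat.sInf_le (s := {n | z ∈ MotzkinSet n}) hz
        omega
    · rintro ⟨h1, h2⟩
      apply le_antisymm (Nat.sInf_le h1)
      have := Nat.sInf_mem (s := {n | z ∈ MotzkinSet n}) ⟨n + 1, h1⟩
      by_contra hc
      exact h2 (motzkin_mono (by omega) this)
  rw [hfib, Set.ncard_sdiff (motzkin_mono (Nat.le_succ n)) (fin n), hcard]
  omega

theorem oddOct_even (k : ℕ) : (OddOct (2*(k+1))).Finite ∧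
    ((OddOct (2*(k+1))).ncard : ℤ) = 14 * 4 ^ (k+1) - 14 * 2 ^ (k+1) + 4 := by
  have h := ww_form (k+1)
  have hp : 1 ≤ 2^k := Nat.one_le_two_pow
  have h2 : 2^(k+1) = 2 * 2^k := by rw [pow_succ]; ring
  have h2' : (2:ℤ)^(k+1) = 2 * ((2^k : ℕ) : ℤ) := by push_cast; rw [pow_succ]; ring
  have h4 : (4:ℤ)^(k+1) = 4 * ((2^k : ℕ) : ℤ)^2 := by
    push_cast; rw [pow_succ, ← pow_mul, mul_comm k 2, pow_mul]; norm_num; ring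
  rw [h2'] at h
  have := oddOct_card (2*(k+1)) (8 * 2^k - 2) (2 * 2^k - 1) (by omega) (by omega) (by omega)
    (by omega) (by omega)
  refine ⟨this.1, ?_⟩
  rw [this.2, h4, h2', Nat.cast_sub (by omega), Nat.cast_sub (by omega)]
  push_cast
  ring

theorem oddOct_odd (k : ℕ) : (OddOct (2*k+1)).Finite ∧
    ((OddOct (2*k+1)).ncard : ℤ) = 28 * 4 ^ k - 20 * 2 ^ k + 4 := by
  have h := ww_form k
  have h' : ww (2*k+1+1) = 2 * ww (2*k) := rfl
  have hp : 1 ≤ 2^k := Nat.one_le_two_pow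
  have h2' : (2:ℤ)^k = ((2^k : ℕ) : ℤ) := by push_cast; rfl
  have h4 : (4:ℤ)^k = ((2^k : ℕ) : ℤ)^2 := by
    push_cast; rw [← pow_mul, mul_comm k 2, pow_mul]; norm_num
  rw [h2'] at h
  have := oddOct_card (2*k+1) (6 * 2^k - 2) (2 * 2^k - 1) (by omega) (by omega) (by omega)
    (by omega) (by omega)
  refine ⟨this.1, ?_⟩
  rw [this.2, h4, h2', Nat.cast_sub (by omega), Nat.cast_sub (by omega)]
  push_cast
  ring

theorem phi_fiber_card (k : ℕ) (hk : 1 ≤ k) :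
    ({z : GaussianInt | phi z = 2 * k}.ncard : ℤ) = 14 * 4 ^ k - 14 * 2 ^ k + 4 ∧
    ({z : GaussianInt | phi z = 2 * k + 1}.ncard : ℤ) = 28 * 4 ^ k - 20 * 2 ^ k + 4 := by
  have hfin : ∀ m, (OddOct (m+1)).Finite := by
    intro m
    rcases Nat.even_or_odd' m with ⟨j, rfl | rfl⟩
    · exact (oddOct_odd j).1
    · exact (oddOct_even j).1
  obtain ⟨j, rfl⟩ : ∃ j, k = j + 1 := ⟨k - 1, by omega⟩
  constructor
  · rw [← (oddOct_even j).2]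
    have := fiber_card (2*j+1) hfin
    exact congrArg Nat.cast this
  · rw [← (oddOct_odd (j+1)).2]
    have := fiber_card (2*(j+1)) hfin
    exact congrArg Nat.cast this
end

section
/- Formula for the minimal Euclidean function on ℤ[i]: if a + bi ≠ 0, 2^j exactly divides a + bi (i.e. 2^j | gcd(a,b) but 2^{j+1} ∤ gcd(a,b)), and n is the least integer with max(|a/2^j|, |b/2^j|) + 2 ≤ w_n, then φ_{ℤ[i]}(a+bi) = n + 2j if |a/2^j| + |b/2^j| + 3 ≤ w_{n+1}, and φ_{ℤ[i]}(a+bi) = n + 2j + 1 otherwise. -/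
def w (n : ℕ) : ℕ := if n % 2 = 0 then 3 * 2 ^ (n / 2) else 4 * 2 ^ (n / 2)

/-- Octagon with side parameters `W`, `V`. -/
def Oc (W V x y : ℤ) : Prop :=
  x + 2 ≤ W ∧ -x + 2 ≤ W ∧ y + 2 ≤ W ∧ -y + 2 ≤ W ∧
  x + y + 3 ≤ V ∧ x - y + 3 ≤ V ∧ -x + y + 3 ≤ V ∧ -x - y + 3 ≤ V

/-- The slightly larger octagon. -/
def Sl (W V x y : ℤ) : Prop :=
  x + 2 ≤ W ∧ -x + 2 ≤ W ∧ y + 2 ≤ W ∧ -y + 2 ≤ W ∧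
  x + y + 2 ≤ V ∧ x - y + 2 ≤ V ∧ -x + y + 2 ≤ V ∧ -x - y + 2 ≤ V

/-- The explicit description of the Motzkin sets. -/
def GG (n : ℕ) (z : GaussianInt) : Prop :=
  z = 0 ∨ ∃ (j m : ℕ) (x y : ℤ), n = m + 2 * j ∧ z = ⟨2 ^ j * x, 2 ^ j * y⟩ ∧
    ¬ (2 ∣ x ∧ 2 ∣ y) ∧ Oc (w m) (w (m + 1)) x y

lemma w_two (n : ℕ) : w (n + 2) = 2 * w n := by
  unfold w
  have h1 : (n + 2) % 2 = n % 2 := by omega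
  have h2 : (n + 2) / 2 = n / 2 + 1 := by omega
  rw [h1, h2, pow_succ]
  split_ifs <;> ring

lemma w_twoZ (n : ℕ) : (w (n + 2) : ℤ) = 2 * w n := by
  rw [w_two]; push_cast; ring

lemma w_addZ (m j : ℕ) : (w (m + 2 * j) : ℤ) = 2 ^ j * w m := by
  induction j with
  | zero => simp
  | succ k ih =>
    have : m + 2 * (k + 1) = (m + 2 * k) + 2 := by ring
    rw [this, w_twoZ, ih, pow_succ]; ring

lemma w_form (n : ℕ) : ∃ k : ℕ,
    (n = 2 * k ∧ (w n : ℤ) = 3 * 2 ^ k ∧ (w (n + 1) : ℤ) = 4 * 2 ^ k) ∨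
    (n = 2 * k + 1 ∧ (w n : ℤ) = 4 * 2 ^ k ∧ (w (n + 1) : ℤ) = 6 * 2 ^ k) := by
  have h0 : w 0 = 3 := rfl
  have h1 : w 1 = 4 := rfl
  have h2 : w 2 = 6 := rfl
  refine ⟨n / 2, ?_⟩
  rcases Nat.mod_two_eq_zero_or_one n with h | h
  · left
    have e : n = 0 + 2 * (n / 2) := by omega
    have e' : n + 1 = 1 + 2 * (n / 2) := by omega
    refine ⟨by omega, ?_, ?_⟩
    · conv_lhs => rw [e, w_addZ, h0]
      push_cast; ring
    · rw [e', w_addZ, h1]; push_cast; ring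
  · right
    have e : n = 1 + 2 * (n / 2) := by omega
    have e' : n + 1 = 2 + 2 * (n / 2) := by omega
    refine ⟨by omega, ?_, ?_⟩
    · conv_lhs => rw [e, w_addZ, h1]
      push_cast; ring
    · rw [e', w_addZ, h2]; push_cast; ring

/-- The linear facts about consecutive values of `w`. -/
lemma w_lin (n : ℕ) : ∃ t : ℤ, 1 ≤ t ∧ (w (n + 2) : ℤ) = 2 * w n ∧
    (((w n : ℤ) = 3 * t ∧ (w (n + 1) : ℤ) = 4 * t) ∨
     ((w n : ℤ) = 4 * t ∧ (w (n + 1) : ℤ) = 6 * t)) := by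
  obtain ⟨k, h⟩ := w_form n
  refine ⟨2 ^ k, one_le_pow₀ (by norm_num), w_twoZ n, ?_⟩
  rcases h with ⟨_, h⟩ | ⟨_, h⟩
  · exact Or.inl h
  · exact Or.inr h

lemma oct_mono {m : ℕ} {x y : ℤ} (h : Oc (w m) (w (m + 1)) x y) :
    Oc (w (m + 1)) (w (m + 2)) x y := by
  obtain ⟨t, ht, h2, h3⟩ := w_lin m
  unfold Oc at *
  omega

lemma GG_mono {n : ℕ} {z : GaussianInt} (h : GG n z) : GG (n + 1) z := by
  rcases h with h | ⟨j, m, x, y, hn, hz, ho, hO⟩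
  · exact Or.inl h
  · exact Or.inr ⟨j, m + 1, x, y, by omega, hz, ho, oct_mono hO⟩

lemma scale_le {T a b : ℤ} (hT : 1 ≤ T) (c : ℤ) (hc : 0 ≤ c) (h : a + c ≤ b) :
    T * a + c ≤ T * b := by
  nlinarith [mul_le_mul_of_nonneg_left h (by omega : 0 ≤ T), mul_le_mul_of_nonneg_right hT hc]

lemma oct_scale {T W V x y : ℤ} (hT : 1 ≤ T) (h : Oc W V x y) :
    Oc (T * W) (T * V) (T * x) (T * y) := by
  obtain ⟨h1, h2, h3, h4, h5, h6, h7, h8⟩ := h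
  have g1 := scale_le hT 2 (by norm_num) h1
  have g2 := scale_le hT 2 (by norm_num) h2
  have g3 := scale_le hT 2 (by norm_num) h3
  have g4 := scale_le hT 2 (by norm_num) h4
  have g5 := scale_le hT 3 (by norm_num) h5
  have g6 := scale_le hT 3 (by norm_num) h6
  have g7 := scale_le hT 3 (by norm_num) h7
  have g8 := scale_le hT 3 (by norm_num) h8
  refine ⟨?_, ?_, ?_, ?_, ?_, ?_, ?_, ?_⟩ <;> linarith

lemma oct_of_GG {n : ℕ} {z : GaussianInt} (h : GG n z) :
    Oc (w n) (w (n + 1)) z.re z.im := by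
  rcases h with h | ⟨j, m, x, y, hn, hz, ho, hO⟩
  · obtain ⟨t, ht, h2, h3⟩ := w_lin n
    subst h
    simp only [Oc, Zsqrtd.re_zero, Zsqrtd.im_zero]
    omega
  · subst hz
    have e : n + 1 = (m + 1) + 2 * j := by omega
    rw [e, hn, w_addZ, w_addZ]
    exact oct_scale (one_le_pow₀ (by norm_num)) hO

lemma GG_of_oct {n : ℕ} {x y : ℤ} (h : Oc (w n) (w (n + 1)) x y) (ho : ¬ (2 ∣ x ∧ 2 ∣ y)) :
    GG n ⟨x, y⟩ :=
  Or.inr ⟨0, n, x, y, by omega, by simp, ho, h⟩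

lemma oct_up {n : ℕ} {x y : ℤ} (h : Oc (w n) (w (n + 1)) x y) :
    Oc (w (n + 1)) (w (n + 2)) (x - y) (x + y) := by
  obtain ⟨t, ht, h2, h3⟩ := w_lin n
  unfold Oc at *
  omega

lemma oct_up_one {n : ℕ} {x y : ℤ} (h : Oc (w n) (w (n + 1)) x y) :
    Oc (w (n + 1)) (w (n + 2)) (x - y - 1) (x + y) := by
  obtain ⟨t, ht, h2, h3⟩ := w_lin n
  unfold Oc at *
  omega

/-- multiplication by `1 + i` sends level `n` to level `n+1` -/
lemma GG_up {n : ℕ} {z : GaussianInt} (h : GG n z) : GG (n + 1) (⟨1, 1⟩ * z) := by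
  rcases h with h | ⟨j, m, x, y, hn, hz, ho, hO⟩
  · left; simp [h]
  · right
    by_cases hp : 2 ∣ x + y
    · -- s even
      cases m with
      | zero =>
        exfalso
        have h0 : w 0 = 3 := rfl
        have h1 : w (0 + 1) = 4 := rfl
        rw [h0, h1] at hO
        unfold Oc at hO
        push_cast at hO
        omega
      | succ m =>
        obtain ⟨t, ht, h2, h3⟩ := w_lin m
        have h4 := w_twoZ (m + 1)
        refine ⟨j + 1, m, (x - y) / 2, (x + y) / 2, by omega, ?_, by omega, ?_⟩
        · rw [hz, pow_succ]
          have e1 : 2 * ((x - y) / 2) = x - y := by omega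
          have e2 : 2 * ((x + y) / 2) = x + y := by omega
          ext
          · simp only [Zsqrtd.re_mul]
            rw [mul_assoc ((2:ℤ) ^ j), e1]; ring
          · simp only [Zsqrtd.im_mul]
            rw [mul_assoc ((2:ℤ) ^ j), e2]; ring
        · have e : m + 1 + 1 = m + 2 := rfl
          rw [e] at hO
          unfold Oc at *
          omega
    · refine ⟨j, m + 1, x - y, x + y, by omega, ?_, by omega, oct_up hO⟩
      rw [hz]
      ext
      · simp only [Zsqrtd.re_mul]; ring
      · simp only [Zsqrtd.im_mul]; ring

/-- division by `1 + i` sends level `n+1` to level `n` -/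
lemma GG_down {n : ℕ} {z : GaussianInt} (h : GG (n + 1) (⟨1, 1⟩ * z)) : GG n z := by
  rcases h with h | ⟨j, m, x, y, hn, hz, ho, hO⟩
  · left
    have h1 := congrArg Zsqrtd.re h
    have h2 := congrArg Zsqrtd.im h
    simp only [Zsqrtd.re_mul, Zsqrtd.im_mul, Zsqrtd.re_zero, Zsqrtd.im_zero] at h1 h2
    ext
    · simp only [Zsqrtd.re_zero]; omega
    · simp only [Zsqrtd.im_zero]; omega
  · have h1 := congrArg Zsqrtd.re hz
    have h2 := congrArg Zsqrtd.im hz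
    simp only [Zsqrtd.re_mul, Zsqrtd.im_mul] at h1 h2
    right
    by_cases hp : 2 ∣ x + y
    · cases m with
      | zero =>
        exfalso
        have h0 : w 0 = 3 := rfl
        have h1 : w (0 + 1) = 4 := rfl
        rw [h0, h1] at hO
        unfold Oc at hO
        push_cast at hO
        omega
      | succ m =>
        obtain ⟨t, ht, h2', h3⟩ := w_lin m
        have h4 := w_twoZ (m + 1)
        obtain ⟨c, hc⟩ := hp
        refine ⟨j, m, c, c - x, by omega, ?_, by omega, ?_⟩
        · have hy : y = 2 * c - x := by omega
          rw [hy] at h2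
          ext
          · show z.re = 2 ^ j * c
            linarith
          · show z.im = 2 ^ j * (c - x)
            linarith
        · have e : m + 1 + 1 = m + 2 := rfl
          rw [e] at hO
          unfold Oc at *
          omega
    · cases j with
      | zero => exfalso; simp at h1 h2; omega
      | succ j =>
        rw [pow_succ, mul_assoc, mul_assoc] at *
        have key : z.re = 2 ^ j * (x + y) ∧ z.im = 2 ^ j * (y - x) := by
          constructor <;> linarith
        refine ⟨j, m + 1, x + y, y - x, by omega, ?_, by omega, ?_⟩
        · ext
          · exact key.1
          · exact key.2
        · obtain ⟨t, ht, h2', h3⟩ := w_lin m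
          have e : m + 1 + 1 = m + 2 := rfl
          rw [e]
          unfold Oc at *
          omega

/-- Far-out points. -/
def Far (W V p q : ℤ) : Prop :=
  ((V - W ≤ |p| ∧ V - W ≤ |q|) ∨ 2 * W - V ≤ |p| - |q| ∨ 2 * W - V ≤ |q| - |p|)

lemma two_adic (x y : ℤ) (h : ¬ (x = 0 ∧ y = 0)) : ∃ (j : ℕ) (a b : ℤ),
    x = 2 ^ j * a ∧ y = 2 ^ j * b ∧ ¬ (2 ∣ a ∧ 2 ∣ b) := by
  induction hN : x.natAbs + y.natAbs using Nat.strong_induction_on generalizing x y with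
  | _ N ih =>
    by_cases hd : 2 ∣ x ∧ 2 ∣ y
    · obtain ⟨⟨c, hc⟩, ⟨d, hd⟩⟩ := hd
      obtain ⟨j, a, b, h1, h2, h3⟩ := ih (c.natAbs + d.natAbs) (by omega) c d (by omega) rfl
      exact ⟨j + 1, a, b, by rw [hc, h1, pow_succ]; ring, by rw [hd, h2, pow_succ]; ring, h3⟩
    · exact ⟨0, x, y, by simp, by simp, hd⟩

lemma far_scale {T W V x y : ℤ} (hT : 1 ≤ T) (h : Far W V x y) :
    Far (T * W) (T * V) (T * x) (T * y) := by
  have hT0 : 0 ≤ T := by omega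
  unfold Far at *
  rw [abs_mul, abs_mul, abs_of_nonneg hT0]
  rcases h with ⟨h1, h2⟩ | h | h
  · left; constructor <;> nlinarith
  · right; left; nlinarith
  · right; right; nlinarith

lemma sl_abs {W V x y : ℤ} : Sl W V x y ↔ (|x| + 2 ≤ W ∧ |y| + 2 ≤ W ∧ |x| + |y| + 2 ≤ V) := by
  unfold Sl
  rcases abs_cases x with ⟨h1, h1'⟩ | ⟨h1, h1'⟩ <;> rcases abs_cases y with ⟨h2, h2'⟩ | ⟨h2, h2'⟩ <;>
    rw [h1, h2] <;> omega

lemma oc_abs {W V x y : ℤ} : Oc W V x y ↔ (|x| + 2 ≤ W ∧ |y| + 2 ≤ W ∧ |x| + |y| + 3 ≤ V) := by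
  unfold Oc
  rcases abs_cases x with ⟨h1, h1'⟩ | ⟨h1, h1'⟩ <;> rcases abs_cases y with ⟨h2, h2'⟩ | ⟨h2, h2'⟩ <;>
    rw [h1, h2] <;> omega

/-- A point of the larger octagon is in the set or far out. -/
lemma dich {n : ℕ} {p q : ℤ} (h : Sl (w n) (w (n + 1)) p q) :
    GG n ⟨p, q⟩ ∨ Far (w n) (w (n + 1)) p q := by
  by_cases h0 : p = 0 ∧ q = 0
  · left; left; rw [h0.1, h0.2]; rfl
  obtain ⟨j, x, y, hp, hq, ho⟩ := two_adic p q h0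
  have hT : (1:ℤ) ≤ 2 ^ j := one_le_pow₀ (by norm_num)
  rw [sl_abs] at h
  by_cases hj : 2 * j ≤ n
  · obtain ⟨m, rfl⟩ : ∃ m, n = m + 2 * j := ⟨n - 2 * j, by omega⟩
    by_cases hO : Oc (w m) (w (m + 1)) x y
    · left; right
      exact ⟨j, m, x, y, rfl, by rw [hp, hq], ho, hO⟩
    · right
      have e : m + 2 * j + 1 = (m + 1) + 2 * j := by omega
      rw [e, w_addZ, w_addZ] at h ⊢
      rw [hp, hq]
      apply far_scale hT
      rw [hp, hq, abs_mul, abs_mul, abs_of_nonneg (by omega : (0:ℤ) ≤ 2 ^ j)] at h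
      obtain ⟨h1, h2, h3⟩ := h
      have g1 : |x| < w m := lt_of_mul_lt_mul_left (by linarith : (2:ℤ) ^ j * |x| < 2 ^ j * w m) (by omega)
      have g2 : |y| < w m := lt_of_mul_lt_mul_left (by linarith : (2:ℤ) ^ j * |y| < 2 ^ j * w m) (by omega)
      have g3 : |x| + |y| < w (m + 1) :=
        lt_of_mul_lt_mul_left (by linarith : (2:ℤ) ^ j * (|x| + |y|) < 2 ^ j * w (m + 1)) (by omega)
      rw [oc_abs] at hO
      obtain ⟨t, ht, h2', h3'⟩ := w_lin m
      have := abs_nonneg x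
      have := abs_nonneg y
      unfold Far
      omega
  · right
    obtain ⟨k, hk⟩ := w_form n
    have hjk : k + 1 ≤ j := by omega
    have hTk : (2:ℤ) * 2 ^ k ≤ 2 ^ j := by
      rw [← pow_succ']; exact pow_le_pow_right₀ (by norm_num) hjk
    rw [hp, hq, abs_mul, abs_mul, abs_of_nonneg (by omega : (0:ℤ) ≤ 2 ^ j)] at h
    have hx0 := abs_nonneg x
    have hy0 := abs_nonneg y
    have hx : |x| < 2 := lt_of_mul_lt_mul_left (by omega : (2:ℤ) ^ j * |x| < 2 ^ j * 2) (by omega)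
    have hy : |y| < 2 := lt_of_mul_lt_mul_left (by omega : (2:ℤ) ^ j * |y| < 2 ^ j * 2) (by omega)
    have hxy : ¬ (|x| = 0 ∧ |y| = 0) := by
      rintro ⟨a, b⟩
      rw [abs_eq_zero] at a b
      apply ho; rw [a, b]; simp
    unfold Far
    rw [hp, hq, abs_mul, abs_mul, abs_of_nonneg (by omega : (0:ℤ) ≤ 2 ^ j)]
    have cx : |x| = 0 ∨ |x| = 1 := by omega
    have cy : |y| = 0 ∨ |y| = 1 := by omega
    rcases cx with cx | cx <;> rcases cy with cy | cy <;> rw [cx, cy] at h hxy ⊢ <;>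
      simp only [mul_one, mul_zero] at h ⊢ <;> omega

/-- some associate of `(a,b)` can be subtracted from `(p,q)` to land in the octagon -/
def Hit (W V a b p q : ℤ) : Prop :=
  Oc W V (p - a) (q - b) ∨ Oc W V (p + b) (q - a) ∨ Oc W V (p + a) (q + b) ∨ Oc W V (p - b) (q + a)

lemma core0 {n : ℕ} {a b p q : ℤ} (hp : 0 ≤ p) (hq : 0 ≤ q) (hb : 0 ≤ b) (hab : b ≤ a)
    (hβ : Oc (w (n + 1)) (w (n + 2)) a b) (hr : Sl (w n) (w (n + 1)) p q)
    (hodd : (a + b) % 2 = 1) (heven : (p + q) % 2 = 0) (hf : Far (w n) (w (n + 1)) p q) :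
    Hit (w n) (w (n + 1)) a b p q := by
  obtain ⟨t, ht, h2, h3⟩ := w_lin n
  unfold Far at hf
  rw [abs_of_nonneg hp, abs_of_nonneg hq] at hf
  have : Oc (w n) (w (n + 1)) (p - a) (q - b) ∨ Oc (w n) (w (n + 1)) (p + b) (q - a) := by
    unfold Oc Sl at *
    generalize (w n : ℤ) = W at *
    generalize (w (n + 1) : ℤ) = V at *
    generalize (w (n + 2) : ℤ) = U at *
    subst h2
    omega
  rcases this with h | h
  · exact Or.inl h
  · exact Or.inr (Or.inl h)

lemma core1 {n : ℕ} {a b p q : ℤ} (hp : 0 ≤ p) (hq : 0 ≤ q)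
    (hβ : Oc (w (n + 1)) (w (n + 2)) a b) (hr : Sl (w n) (w (n + 1)) p q)
    (hodd : (a + b) % 2 = 1) (heven : (p + q) % 2 = 0) (hf : Far (w n) (w (n + 1)) p q) :
    Hit (w n) (w (n + 1)) a b p q := by
  -- rotate to the first quadrant
  have main : ∀ a b : ℤ, 0 ≤ a → 0 ≤ b → Oc (w (n + 1)) (w (n + 2)) a b → (a + b) % 2 = 1 →
      Hit (w n) (w (n + 1)) a b p q := by
    intro a b ha hb hβ hodd
    rcases le_total b a with h | h
    · exact core0 hp hq hb h hβ hr hodd heven hf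
    · have := core0 (n := n) (a := b) (b := a) (p := q) (q := p) hq hp ha h
        (by unfold Oc at *; omega) (by unfold Sl at *; omega) (by omega) (by omega)
        (by unfold Far at *; omega)
      unfold Hit Oc at *
      clear hβ hf hr
      rcases this with h | h | h | h
      · left; omega
      · right; right; right; omega
      · right; right; left; omega
      · right; left; omega
  rcases le_total 0 a with ha | ha <;> rcases le_total 0 b with hb | hb
  · exact main a b ha hb hβ hodd
  · have := main (-b) a (by omega) ha (by unfold Oc at *; omega) (by omega)
    simp only [Hit, sub_neg_eq_add, ← sub_eq_add_neg] at *
    tauto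
  · have := main b (-a) hb (by omega) (by unfold Oc at *; omega) (by omega)
    simp only [Hit, sub_neg_eq_add, ← sub_eq_add_neg] at *
    tauto
  · have := main (-a) (-b) (by omega) (by omega) (by unfold Oc at *; omega) (by omega)
    simp only [Hit, sub_neg_eq_add, ← sub_eq_add_neg] at *
    tauto

lemma oc_neg1 {W V x y : ℤ} (h : Oc W V x y) : Oc W V (-x) y := by unfold Oc at *; omega
lemma oc_neg2 {W V x y : ℤ} (h : Oc W V x y) : Oc W V x (-y) := by unfold Oc at *; omega

lemma hit_neg1 {W V a b p q : ℤ} (h : Hit W V (-a) b (-p) q) : Hit W V a b p q := by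
  unfold Hit at *
  rcases h with h | h | h | h <;> have h' := oc_neg1 h
  · left; convert h' using 1; ring
  · right; right; right; convert h' using 1 <;> ring
  · right; right; left; convert h' using 1; ring
  · right; left; convert h' using 1 <;> ring

lemma hit_neg2 {W V a b p q : ℤ} (h : Hit W V a (-b) p (-q)) : Hit W V a b p q := by
  unfold Hit at *
  rcases h with h | h | h | h <;> have h' := oc_neg2 h
  · left; convert h' using 1; ring
  · right; right; right; convert h' using 1 <;> ring
  · right; right; left; convert h' using 1; ring
  · right; left; convert h' using 1 <;> ring

lemma core_s19 {n : ℕ} {a b p q : ℤ}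
    (hβ : Oc (w (n + 1)) (w (n + 2)) a b) (hr : Sl (w n) (w (n + 1)) p q)
    (hodd : (a + b) % 2 = 1) (heven : (p + q) % 2 = 0) (hf : Far (w n) (w (n + 1)) p q) :
    Hit (w n) (w (n + 1)) a b p q := by
  have main : ∀ a b p q : ℤ, 0 ≤ q → Oc (w (n + 1)) (w (n + 2)) a b →
      Sl (w n) (w (n + 1)) p q → (a + b) % 2 = 1 → (p + q) % 2 = 0 →
      Far (w n) (w (n + 1)) p q → Hit (w n) (w (n + 1)) a b p q := by
    intro a b p q hq hβ hr hodd heven hf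
    rcases le_total 0 p with hp | hp
    · exact core1 hp hq hβ hr hodd heven hf
    · apply hit_neg1
      exact core1 (by omega) hq (oc_neg1 hβ) (by unfold Sl at *; omega) (by omega) (by omega)
        (by unfold Far at *; rwa [abs_neg])
  rcases le_total 0 q with hq | hq
  · exact main a b p q hq hβ hr hodd heven hf
  · apply hit_neg2
    exact main a (-b) p (-q) (by omega) (oc_neg2 hβ) (by unfold Sl at *; omega) (by omega) (by omega)
        (by unfold Far at *; rwa [abs_neg])

lemma round_div (P N : ℤ) (hN : 0 < N) : ∃ q : ℤ, 2 * (P - q * N) ≤ N ∧ -N ≤ 2 * (P - q * N) := by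
  refine ⟨(2 * P + N) / (2 * N), ?_⟩
  have h1 := Int.mul_ediv_add_emod (2 * P + N) (2 * N)
  have h2 := Int.emod_nonneg (2 * P + N) (by omega : 2 * N ≠ 0)
  have h3 := Int.emod_lt_of_pos (2 * P + N) (by omega : 0 < 2 * N)
  constructor <;> nlinarith

lemma lin_bound {c d P Q N : ℤ} (hP : |2 * P| ≤ N) (hQ : |2 * Q| ≤ N) :
    2 * (c * P + d * Q) ≤ (|c| + |d|) * N := by
  have h1 : c * (2 * P) ≤ |c| * N :=
    (le_abs_self _).trans (by rw [abs_mul]; exact mul_le_mul_of_nonneg_left hP (abs_nonneg _))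
  have h2 : d * (2 * Q) ≤ |d| * N :=
    (le_abs_self _).trans (by rw [abs_mul]; exact mul_le_mul_of_nonneg_left hQ (abs_nonneg _))
  nlinarith

lemma lin_bound' {c d P Q N r K : ℤ} (hN : 0 < N) (hP : |2 * P| ≤ N) (hQ : |2 * Q| ≤ N)
    (hr : N * r = c * P + d * Q) (hK : |c| + |d| ≤ K) : 2 * r ≤ K := by
  have h := lin_bound (c := c) (d := d) hP hQ
  have h2 : N * (2 * r) ≤ N * K := by nlinarith
  exact le_of_mul_le_mul_left h2 hN

/-- The covering lemma. -/
lemma cover_s19 {n : ℕ} {β : GaussianInt} (h0 : β ≠ 0)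
    (hβ : Oc (w (n + 1)) (w (n + 2)) β.re β.im) (x : GaussianInt) :
    ∃ r : GaussianInt, β ∣ x - r ∧ Sl (w n) (w (n + 1)) r.re r.im := by
  obtain ⟨a, b⟩ := β
  obtain ⟨u, v⟩ := x
  have hN : 0 < a * a + b * b := by
    rcases eq_or_ne a 0 with ha | ha
    · rcases eq_or_ne b 0 with hb | hb
      · exact absurd (by rw [ha, hb]; rfl) h0
      · have := mul_self_pos.mpr hb; nlinarith [mul_self_nonneg a]
    · have := mul_self_pos.mpr ha; nlinarith [mul_self_nonneg b]
  obtain ⟨s, hs1, hs2⟩ := round_div (u * a + v * b) _ hN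
  obtain ⟨t, ht1, ht2⟩ := round_div (v * a - u * b) _ hN
  set N := a * a + b * b with hNd
  set P := (u * a + v * b) - s * N with hPd
  set Q := (v * a - u * b) - t * N with hQd
  have hP : |2 * P| ≤ N := abs_le.mpr ⟨by linarith, by linarith⟩
  have hQ : |2 * Q| ≤ N := abs_le.mpr ⟨by linarith, by linarith⟩
  have hx : N * (u - (a * s - b * t)) = a * P + (-b) * Q := by
    rw [hPd, hQd, hNd]; ring
  have hy : N * (v - (a * t + b * s)) = b * P + a * Q := by
    rw [hPd, hQd, hNd]; ring
  refine ⟨⟨u - (a * s - b * t), v - (a * t + b * s)⟩, ⟨⟨s, t⟩, ?_⟩, ?_⟩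
  · ext
    · simp only [Zsqrtd.re_mul, Zsqrtd.re_sub]; ring
    · simp only [Zsqrtd.im_mul, Zsqrtd.im_sub]; ring
  · set X := u - (a * s - b * t)
    set Y := v - (a * t + b * s)
    obtain ⟨τ, hτ, h2, h3⟩ := w_lin n
    have hab : |a| + |b| ≤ 2 * w n - 3 := by
      rcases oc_abs.mp hβ with ⟨_, _, h⟩
      simp only at h
      omega
    have hab2 : |a + b| + |a - b| ≤ 2 * w (n + 1) - 4 := by
      unfold Oc at hβ
      simp only at hβ
      rcases abs_cases (a + b) with ⟨e1, _⟩ | ⟨e1, _⟩ <;>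
        rcases abs_cases (a - b) with ⟨e2, _⟩ | ⟨e2, _⟩ <;> rw [e1, e2] <;> omega
    have k1 := lin_bound' (K := 2 * w n - 3) hN hP hQ hx (by rw [abs_neg]; exact hab)
    have k2 := lin_bound' (K := 2 * w n - 3) (r := -X) (c := -a) (d := b) hN hP hQ (by linarith)
      (by rw [abs_neg]; exact hab)
    have k3 := lin_bound' (K := 2 * w n - 3) hN hP hQ hy (by rw [add_comm]; exact hab)
    have k4 := lin_bound' (K := 2 * w n - 3) (r := -Y) (c := -b) (d := -a) hN hP hQ (by linarith)
      (by rw [abs_neg, abs_neg, add_comm]; exact hab)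
    have k5 := lin_bound' (K := 2 * w (n + 1) - 4) (r := X + Y) (c := a + b) (d := a - b) hN hP hQ (by linarith) hab2
    have k6 := lin_bound' (K := 2 * w (n + 1) - 4) (r := X - Y) (c := a - b) (d := -(a + b)) hN hP hQ (by linarith)
      (by rw [abs_neg, add_comm]; exact hab2)
    have k7 := lin_bound' (K := 2 * w (n + 1) - 4) (r := -X + Y) (c := -(a - b)) (d := a + b) hN hP hQ (by linarith)
      (by rw [abs_neg, add_comm]; exact hab2)
    have k8 := lin_bound' (K := 2 * w (n + 1) - 4) (r := -X - Y) (c := -(a + b)) (d := -(a - b)) hN hP hQ (by linarith)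
      (by rw [abs_neg, abs_neg]; exact hab2)
    unfold Sl
    refine ⟨?_, ?_, ?_, ?_, ?_, ?_, ?_, ?_⟩ <;> simp only <;> omega

/-- odd points of the larger octagon -/
lemma GG_of_sl_odd {n : ℕ} {r : GaussianInt} (h : Sl (w n) (w (n + 1)) r.re r.im)
    (ho : (r.re + r.im) % 2 = 1) : GG n r := by
  apply GG_of_oct (x := r.re) (y := r.im)
  · obtain ⟨t, ht, h2, h3⟩ := w_lin n
    unfold Oc Sl at *
    omega
  · omega

/-- the odd case of surjectivity -/
lemma surj_odd {n : ℕ} {β : GaussianInt} (hβ : GG (n + 1) β)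
    (ho : (β.re + β.im) % 2 = 1) (x : GaussianInt) : ∃ r, GG n r ∧ β ∣ x - r := by
  have hO := oct_of_GG hβ
  have h0 : β ≠ 0 := by rintro rfl; simp at ho
  obtain ⟨r, ⟨c, hc⟩, hr⟩ := cover_s19 h0 hO x
  rcases Int.emod_two_eq_zero_or_one (r.re + r.im) with he | he
  · rcases dich hr with h | h
    · exact ⟨r, h, ⟨c, hc⟩⟩
    · have fin : ∀ y : GaussianInt, Oc (w n) (w (n + 1)) y.re y.im → (y.re + y.im) % 2 = 1 → GG n y := by
        intro y hy hy'
        exact GG_of_oct (x := y.re) (y := y.im) hy (by omega)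
      rcases core_s19 hO hr ho he h with h | h | h | h
      · refine ⟨r - β, fin _ (by simpa using h) (by simp; omega), ⟨c + 1, ?_⟩⟩
        linear_combination hc
      · refine ⟨r - ⟨0, 1⟩ * β, fin _ (by simpa using h) (by simp; omega), ⟨c + ⟨0, 1⟩, ?_⟩⟩
        linear_combination hc
      · refine ⟨r + β, fin _ (by simpa using h) (by simp; omega), ⟨c - 1, ?_⟩⟩
        linear_combination hc
      · refine ⟨r + ⟨0, 1⟩ * β, fin _ (by simpa [sub_eq_add_neg] using h) (by simp; omega), ⟨c - ⟨0, 1⟩, ?_⟩⟩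
        linear_combination hc
  · exact ⟨r, GG_of_sl_odd hr he, ⟨c, hc⟩⟩

lemma even_dvd (z : GaussianInt) (h : (z.re + z.im) % 2 = 0) : ∃ y, z = ⟨1, 1⟩ * y := by
  refine ⟨⟨(z.re + z.im) / 2, (z.im - z.re) / 2⟩, ?_⟩
  ext
  · simp only [Zsqrtd.re_mul]; omega
  · simp only [Zsqrtd.im_mul]; omega

lemma dvd_motzkin {n : ℕ} : ∀ {β γ : GaussianInt}, β ≠ 0 → γ ∣ β → β ∈ MotzkinSet n →
    γ ∈ MotzkinSet n := by
  induction n with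
  | zero =>
    intro β γ h0 hd h
    rcases h with h | h
    · exact absurd h h0
    · exact Or.inr (isUnit_of_dvd_unit hd h)
  | succ n ih =>
    intro β γ h0 hd h
    rcases h with h | h
    · exact Or.inl (ih h0 hd h)
    · right
      intro x
      obtain ⟨r, hr, hx⟩ := h x
      exact ⟨r, hr, hd.trans hx⟩

/-- elements of a Motzkin set admit remainders `r` with `(1+i) r` at the same level -/
lemma motzkin_rem {n : ℕ} (IH : ∀ m ≤ n, ∀ z, z ∈ MotzkinSet m ↔ GG m z) {γ : GaussianInt}
    (h0 : γ ≠ 0) (h : γ ∈ MotzkinSet n) (x : GaussianInt) :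
    ∃ r, GG n (⟨1, 1⟩ * r) ∧ γ ∣ x - r := by
  induction n with
  | zero =>
    rcases h with h | h
    · exact absurd h h0
    · exact ⟨0, Or.inl (by simp), h.dvd⟩
  | succ n ih =>
    rcases h with h | h
    · obtain ⟨r, hr, hx⟩ := ih (fun m hm => IH m (by omega)) h
      exact ⟨r, GG_mono hr, hx⟩
    · obtain ⟨r, hr, hx⟩ := h x
      exact ⟨r, GG_up ((IH n (by omega) r).mp hr), hx⟩

lemma oct_norm {W V a b c d : ℤ} (hV : W + 1 ≤ V) (ho : (c + d) % 2 = 1)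
    (h : Oc W V (a * c - b * d) (a * d + b * c)) : Oc W V a b := by
  rcases lt_or_ge (c * c + d * d) 4 with hN | hN
  · have c1 : c ≤ 1 := by nlinarith [mul_self_nonneg d]
    have c2 : -1 ≤ c := by nlinarith [mul_self_nonneg d]
    have d1 : d ≤ 1 := by nlinarith [mul_self_nonneg c]
    have d2 : -1 ≤ d := by nlinarith [mul_self_nonneg c]
    have hc : c = -1 ∨ c = 0 ∨ c = 1 := by omega
    have hd : d = -1 ∨ d = 0 ∨ d = 1 := by omega
    unfold Oc at *
    rcases hc with rfl | rfl | rfl <;> rcases hd with rfl | rfl | rfl <;> omega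
  · obtain ⟨X, hX⟩ : ∃ X, X = a * c - b * d := ⟨_, rfl⟩
    obtain ⟨Y, hY⟩ : ∃ Y, Y = a * d + b * c := ⟨_, rfl⟩
    have e : X ^ 2 + Y ^ 2 = (a * a + b * b) * (c * c + d * d) := by rw [hX, hY]; ring
    rw [← hX, ← hY] at h
    obtain ⟨h1, h2, h3, h4, -⟩ := h
    have hM : 0 ≤ W - 2 := by omega
    have x2 : X ^ 2 ≤ (W - 2) ^ 2 := sq_le_sq' (by omega) (by omega)
    have y2 : Y ^ 2 ≤ (W - 2) ^ 2 := sq_le_sq' (by omega) (by omega)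
    have hab : 0 ≤ a * a + b * b := add_nonneg (mul_self_nonneg a) (mul_self_nonneg b)
    have h5 : (a * a + b * b) * 4 ≤ (a * a + b * b) * (c * c + d * d) :=
      mul_le_mul_of_nonneg_left hN hab
    have s1 : (a + b) ^ 2 ≤ (W - 2) ^ 2 := by nlinarith [sq_nonneg (a - b)]
    have s2 : (a - b) ^ 2 ≤ (W - 2) ^ 2 := by nlinarith [sq_nonneg (a + b)]
    have t1 := abs_le.mp (abs_le_of_sq_le_sq s1 hM)
    have t2 := abs_le.mp (abs_le_of_sq_le_sq s2 hM)
    unfold Oc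
    omega

lemma motzkin_zero (z : GaussianInt) : z ∈ MotzkinSet 0 ↔ GG 0 z := by
  have w0 : w 0 = 3 := rfl
  have w1 : w (0 + 1) = 4 := rfl
  constructor
  · rintro (h | h)
    · exact Or.inl h
    · rw [← Zsqrtd.norm_eq_one_iff] at h
      have h1 : z.re * z.re + z.im * z.im = 1 := by
        have := Zsqrtd.norm_nonneg (d := -1) (by norm_num) z
        have h2 : z.norm = 1 := by omega
        rw [Zsqrtd.norm_def] at h2
        linarith
      have c1 : z.re ≤ 1 := by nlinarith [mul_self_nonneg z.im]
      have c2 : -1 ≤ z.re := by nlinarith [mul_self_nonneg z.im]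
      have d1 : z.im ≤ 1 := by nlinarith [mul_self_nonneg z.re]
      have d2 : -1 ≤ z.im := by nlinarith [mul_self_nonneg z.re]
      have hc : z.re = -1 ∨ z.re = 0 ∨ z.re = 1 := by omega
      have hd : z.im = -1 ∨ z.im = 0 ∨ z.im = 1 := by omega
      refine GG_of_oct (x := z.re) (y := z.im) ?_ ?_
      · rw [w0, w1]
        unfold Oc
        rcases hc with e | e | e <;> rcases hd with f | f | f <;> rw [e, f] at h1 ⊢ <;>
          first | (exfalso; norm_num at h1; done) | norm_num
      · rcases hc with e | e | e <;> rcases hd with f | f | f <;> rw [e, f] at h1 ⊢ <;>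
          first | (exfalso; norm_num at h1; done) | norm_num
  · rintro (h | ⟨j, m, x, y, hn, hz, ho, hO⟩)
    · exact Or.inl h
    · right
      obtain rfl : j = 0 := by omega
      obtain rfl : m = 0 := by omega
      rw [w0, w1] at hO
      unfold Oc at hO
      push_cast at hO
      rw [← Zsqrtd.norm_eq_one_iff, hz, Zsqrtd.norm_def]
      have hc : x = -1 ∨ x = 0 ∨ x = 1 := by omega
      have hd : y = -1 ∨ y = 0 ∨ y = 1 := by omega
      rcases hc with rfl | rfl | rfl <;> rcases hd with rfl | rfl | rfl <;> simp at * <;> omega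

theorem motzkin_iff_s19 (n : ℕ) : ∀ m ≤ n, ∀ z, z ∈ MotzkinSet m ↔ GG m z := by
  induction n with
  | zero =>
    intro m hm z
    obtain rfl : m = 0 := by omega
    exact motzkin_zero z
  | succ n IH =>
    intro m hm z
    rcases Nat.lt_or_ge m (n + 1) with h | h
    · exact IH m (by omega) z
    obtain rfl : m = n + 1 := by omega
    have IHn := IH n le_rfl
    constructor
    · intro hz
      rcases hz with hz | hz
      · exact GG_mono ((IHn z).mp hz)
      by_cases h0 : z = 0
      · exact Or.inl h0
      rcases Int.emod_two_eq_zero_or_one (z.re + z.im) with he | he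
      · obtain ⟨γ, rfl⟩ := even_dvd z he
        apply GG_up
        rw [← IHn]
        obtain ⟨r, hr, c, hc⟩ := hz γ
        have e : r = γ * (1 - ⟨1, 1⟩ * c) := by linear_combination -hc
        refine dvd_motzkin (β := r) ?_ ⟨_, e⟩ hr
        rw [e]
        refine mul_ne_zero (right_ne_zero_of_mul h0) ?_
        intro h
        have h1 := congrArg Zsqrtd.re h
        have h2 := congrArg Zsqrtd.im h
        simp at h1 h2
        omega
      · obtain ⟨y, hy⟩ := even_dvd (z + 1) (by simp; omega)
        obtain ⟨r, hr, c, hc⟩ := hz y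
        have hO := oct_up_one (oct_of_GG ((IHn r).mp hr))
        have e : z * (1 - ⟨1, 1⟩ * c) = ⟨1, 1⟩ * r - 1 := by
          linear_combination hy + ⟨1, 1⟩ * hc
        have h1 := congrArg Zsqrtd.re e
        have h2 := congrArg Zsqrtd.im e
        obtain ⟨t, ht, h2', h3⟩ := w_lin (n + 1)
        refine GG_of_oct (x := z.re) (y := z.im) ?_ (by omega)
        apply oct_norm (c := 1 - (c.re - c.im)) (d := -(c.re + c.im)) (by omega) (by omega)
        simp at h1 h2
        have g1 : z.re * (1 - (c.re - c.im)) - z.im * -(c.re + c.im) = r.re - r.im - 1 := by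
          linarith
        have g2 : z.re * -(c.re + c.im) + z.im * (1 - (c.re - c.im)) = r.re + r.im := by
          linarith
        rw [g1, g2]
        exact hO
    · intro hz
      by_cases h0 : z = 0
      · left; rw [IHn]; exact Or.inl h0
      right
      intro x
      suffices h : ∃ r, GG n r ∧ z ∣ x - r by
        obtain ⟨r, hr, hx⟩ := h
        exact ⟨r, (IHn r).mpr hr, hx⟩
      rcases Int.emod_two_eq_zero_or_one (z.re + z.im) with he | he
      · rcases Int.emod_two_eq_zero_or_one (x.re + x.im) with hx | hx
        · obtain ⟨γ, rfl⟩ := even_dvd z he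
          obtain ⟨y, rfl⟩ := even_dvd x hx
          obtain ⟨r, hr, hd⟩ := motzkin_rem IH (right_ne_zero_of_mul h0) ((IHn γ).mpr (GG_down hz)) y
          exact ⟨_, hr, by rw [← mul_sub]; exact mul_dvd_mul_left _ hd⟩
        · obtain ⟨r, ⟨c, hc⟩, hr⟩ := cover_s19 h0 (oct_of_GG hz) x
          refine ⟨r, GG_of_sl_odd hr ?_, ⟨c, hc⟩⟩
          obtain ⟨γ, rfl⟩ := even_dvd z he
          have h1 := congrArg Zsqrtd.re hc
          have h2 := congrArg Zsqrtd.im hc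
          rw [mul_assoc] at h1 h2
          simp only [Zsqrtd.re_sub, Zsqrtd.im_sub, Zsqrtd.re_mul ⟨1, 1⟩ (γ * c), Zsqrtd.im_mul ⟨1, 1⟩ (γ * c)] at h1 h2
          omega
      · exact surj_odd hz he x

lemma two_pow_unique {j k : ℕ} {x y x' y' : ℤ} (h1 : (2:ℤ) ^ j * x = 2 ^ k * x')
    (h2 : (2:ℤ) ^ j * y = 2 ^ k * y') (h : ¬ (2 ∣ x ∧ 2 ∣ y)) : k ≤ j := by
  by_contra hlt
  obtain ⟨d, rfl⟩ : ∃ d, k = j + (d + 1) := ⟨k - j - 1, by omega⟩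
  have hp : (2:ℤ) ^ j ≠ 0 := by positivity
  rw [pow_add, mul_assoc] at h1 h2
  have e1 := mul_left_cancel₀ hp h1
  have e2 := mul_left_cancel₀ hp h2
  apply h
  rw [e1, e2, pow_succ']
  exact ⟨⟨2 ^ d * x', by ring⟩, ⟨2 ^ d * y', by ring⟩⟩

theorem phi_formula (a b : ℤ) (j n : ℕ)
    (hz : (⟨a, b⟩ : GaussianInt) ≠ 0)
    (hj : (2 ^ j : ℤ) ∣ a ∧ (2 ^ j : ℤ) ∣ b)
    (hj2 : ¬ ((2 ^ (j + 1) : ℤ) ∣ a ∧ (2 ^ (j + 1) : ℤ) ∣ b))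
    (hn : max |a / 2 ^ j| |b / 2 ^ j| + 2 ≤ (w n : ℤ))
    (hleast : ∀ m : ℕ, max |a / 2 ^ j| |b / 2 ^ j| + 2 ≤ (w m : ℤ) → n ≤ m) :
    (|a / 2 ^ j| + |b / 2 ^ j| + 3 ≤ (w (n + 1) : ℤ) →
      phi ⟨a, b⟩ = n + 2 * j) ∧
    (¬ (|a / 2 ^ j| + |b / 2 ^ j| + 3 ≤ (w (n + 1) : ℤ)) →
      phi ⟨a, b⟩ = n + 2 * j + 1) := by
  obtain ⟨⟨x, rfl⟩, ⟨y, rfl⟩⟩ := hj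
  have hp : (2:ℤ) ^ j ≠ 0 := by positivity
  rw [Int.mul_ediv_cancel_left _ hp, Int.mul_ediv_cancel_left _ hp] at *
  have ho : ¬ (2 ∣ x ∧ 2 ∣ y) := by
    rintro ⟨h1, h2⟩
    apply hj2
    rw [pow_succ]
    exact ⟨mul_dvd_mul_left _ h1, mul_dvd_mul_left _ h2⟩
  have hmem : ∀ m, (⟨2 ^ j * x, 2 ^ j * y⟩ : GaussianInt) ∈ MotzkinSet m ↔
      ∃ k, m = k + 2 * j ∧ Oc (w k) (w (k + 1)) x y := by
    intro m
    rw [motzkin_iff_s19 m m le_rfl]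
    constructor
    · rintro (h | ⟨j', k, x', y', hm, he, ho', hO⟩)
      · exact absurd h hz
      · have e1 : (2:ℤ) ^ j * x = 2 ^ j' * x' := congrArg Zsqrtd.re he
        have e2 : (2:ℤ) ^ j * y = 2 ^ j' * y' := congrArg Zsqrtd.im he
        obtain rfl : j = j' := le_antisymm (two_pow_unique e1.symm e2.symm ho') (two_pow_unique e1 e2 ho)
        rw [mul_left_cancel₀ hp e1, mul_left_cancel₀ hp e2]
        exact ⟨k, hm, hO⟩
    · rintro ⟨k, hm, hO⟩
      exact Or.inr ⟨j, k, x, y, hm, rfl, ho, hO⟩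
  have hlow : ∀ m, (⟨2 ^ j * x, 2 ^ j * y⟩ : GaussianInt) ∈ MotzkinSet m →
      ∃ k, m = k + 2 * j ∧ n ≤ k ∧ Oc (w k) (w (k + 1)) x y := by
    intro m hm
    obtain ⟨k, hk, hO⟩ := (hmem m).mp hm
    refine ⟨k, hk, hleast k ?_, hO⟩
    have := oc_abs.mp hO
    rcases max_choice |x| |y| with h | h <;> rw [h] <;> omega
  have hx := le_max_left |x| |y|
  have hy := le_max_right |x| |y|
  constructor
  · intro hs
    have h1 : (⟨2 ^ j * x, 2 ^ j * y⟩ : GaussianInt) ∈ MotzkinSet (n + 2 * j) :=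
      (hmem _).mpr ⟨n, rfl, oc_abs.mpr ⟨by omega, by omega, hs⟩⟩
    apply le_antisymm
    · exact Nat.sInf_le h1
    · obtain ⟨k, hk, hnk, _⟩ := hlow _ (Nat.sInf_mem (s := {m | _ ∈ MotzkinSet m}) ⟨_, h1⟩)
      unfold phi
      omega
  · intro hs
    obtain ⟨t, ht, h2, h3⟩ := w_lin n
    have h1 : (⟨2 ^ j * x, 2 ^ j * y⟩ : GaussianInt) ∈ MotzkinSet (n + 2 * j + 1) :=
      (hmem _).mpr ⟨n + 1, by omega, oc_abs.mpr ⟨by omega, by omega, by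
        show _ ≤ (w (n + 2) : ℤ)
        omega⟩⟩
    apply le_antisymm
    · exact Nat.sInf_le h1
    · obtain ⟨k, hk, hnk, hO⟩ := hlow _ (Nat.sInf_mem (s := {m | _ ∈ MotzkinSet m}) ⟨n + 2 * j + 1, h1⟩)
      have : k ≠ n := by
        rintro rfl
        exact hs (oc_abs.mp hO).2.2
      unfold phi
      omega
end
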